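/- arXiv:1011.1917 — 3 statements merged into one kernel-verified Lean document; each statement's English description precedes it below -/
import Mathlib

section
/- Let Γ be a simple polygon and F a finite set of guards covering the boundary of Γ but not all of Γ, and let R be the hidden region. Then the closure of every connected component of R is a convex polygon. -/
open Set

noncomputable section

/-- Points of the Euclidean plane. -/
abbrev Pt : Type := EuclideanSpace ℝ (Fin 2)

/-- A simple polygon: a compact region of the plane bounded by a simple closed
polygonal curve.  Vertices are indexed by `ℤ`, periodically with period `n`. -/
structure SimplePolygon where
  carrier : Set Pt
  n : ℕ
  three_le : 3 ≤ n
  vertex : ℤ → Pt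
  periodic : ∀ i : ℤ, vertex (i + n) = vertex i
  vertex_inj : ∀ i j : ℤ, 0 ≤ i → i < n → 0 ≤ j → j < n → vertex i = vertex j → i = j
  compact : IsCompact carrier
  connected : IsConnected carrier
  regular : carrier = closure (interior carrier)
  boundary_eq : frontier carrier = ⋃ i : ℤ, segment ℝ (vertex i) (vertex (i + 1))
  adj_edges : ∀ i j : ℤ, (n : ℤ) ∣ (j - (i + 1)) → ¬ (n : ℤ) ∣ (j - i) →
    segment ℝ (vertex i) (vertex (i + 1)) ∩ segment ℝ (vertex j) (vertex (j + 1)) = {vertex j}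
  nonadj_edges : ∀ i j : ℤ, ¬ (n : ℤ) ∣ (j - i) → ¬ (n : ℤ) ∣ (j - (i + 1)) →
    ¬ (n : ℤ) ∣ (i - (j + 1)) →
    Disjoint (segment ℝ (vertex i) (vertex (i + 1))) (segment ℝ (vertex j) (vertex (j + 1)))

/-- `A`, `B` span a (maximal) boundary segment of the set `R`. -/
def IsBoundarySegment (R : Set Pt) (A B : Pt) : Prop :=
  A ≠ B ∧ segment ℝ A B ⊆ frontier R ∧
  ∀ A' B' : Pt, segment ℝ A B ⊆ segment ℝ A' B' → segment ℝ A' B' ⊆ frontier R →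
    segment ℝ A' B' = segment ℝ A B

/-- `ℓ` is a support line of `R`: a line containing a boundary segment of the closure of `R`. -/
def IsSupportLine (R : Set Pt) (ℓ : AffineSubspace ℝ Pt) : Prop :=
  ∃ A B : Pt, IsBoundarySegment (closure R) A B ∧ ℓ = affineSpan ℝ ({A, B} : Set Pt)

/-- Two regions are adjacent when they share a common boundary edge
(a nondegenerate segment). -/
def AdjacentRegions (R R' : Set Pt) : Prop :=
  R ≠ R' ∧ ∃ C D : Pt, C ≠ D ∧ segment ℝ C D ⊆ closure R ∩ closure R'

namespace SimplePolygon

variable (Γ : SimplePolygon)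

/-- `G` sees `A`: the segment `GA` is contained in the polygon. -/
def Sees (G A : Pt) : Prop := segment ℝ G A ⊆ Γ.carrier

/-- The guard set `F` (visually) covers the set `S`. -/
def Covers (F S : Set Pt) : Prop := ∀ A ∈ S, ∃ G ∈ F, Γ.Sees G A

/-- The view of a point `P`: all points of the polygon seen by `P`. -/
def View (P : Pt) : Set Pt := {A | A ∈ Γ.carrier ∧ Γ.Sees P A}

/-- The hidden region of a guard configuration `F`: points of the polygon seen by no guard. -/
def Hidden (F : Set Pt) : Set Pt := {A | A ∈ Γ.carrier ∧ ∀ G ∈ F, ¬ Γ.Sees G A}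

/-- The polygon is normal: every configuration of guards covering the walls covers everything. -/
def Normal : Prop :=
  ∀ F : Set Pt, F ⊆ Γ.carrier → Γ.Covers F (frontier Γ.carrier) → Γ.Covers F Γ.carrier

/-- The polygon is normal with respect to `A`: every configuration of guards inside `A`
covering the walls covers everything. -/
def NormalWrt (A : Set Pt) : Prop :=
  ∀ F : Set Pt, F ⊆ A → Γ.Covers F (frontier Γ.carrier) → Γ.Covers F Γ.carrier

/-- The corner at `vertex i` is reflex (interior angle exceeding 180°): points slightly
displaced from the vertex in the direction bisecting the (undirected) corner angle lie
outside the polygon. -/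
def IsReflexCorner (i : ℤ) : Prop :=
  ∃ δ > (0 : ℝ), ∀ ε : ℝ, 0 < ε → ε < δ →
    Γ.vertex i + ε • ((Γ.vertex (i - 1) - Γ.vertex i) + (Γ.vertex (i + 1) - Γ.vertex i)) ∉
      Γ.carrier

/-- The set of (indices in one period of) reflex corners of the polygon. -/
def reflexCorners : Set ℤ := {i : ℤ | 0 ≤ i ∧ i < Γ.n ∧ Γ.IsReflexCorner i}

/-- `(P, i)` is a feasible pair: `vertex i` is a reflex corner visible from `P` and the two
walls at the corner lie (weakly) on the same side of the line through `P` and `vertex i`. -/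
def IsFeasible (P : Pt) (i : ℤ) : Prop :=
  Γ.IsReflexCorner i ∧ P ≠ Γ.vertex i ∧ Γ.Sees P (Γ.vertex i) ∧
  ∃ f : Pt →ₗ[ℝ] ℝ, f ≠ 0 ∧ f (Γ.vertex i - P) = 0 ∧
    0 ≤ f (Γ.vertex (i - 1) - P) ∧ 0 ≤ f (Γ.vertex (i + 1) - P)

/-- `w` is a window of `P`: the segment from a reflex corner `C = vertex i` of a feasible
pair `(P, i)` to the farthest boundary point visible from `P` on the ray `P C` beyond `C`. -/
def IsWindow (P : Pt) (w : Set Pt) : Prop :=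
  ∃ i : ℤ, ∃ W : Pt, Γ.IsFeasible P i ∧
    (∃ t : ℝ, 0 ≤ t ∧ W = Γ.vertex i + t • (Γ.vertex i - P)) ∧
    W ∈ frontier Γ.carrier ∧ Γ.Sees P W ∧
    (∀ W' : Pt, (∃ t : ℝ, 0 ≤ t ∧ W' = Γ.vertex i + t • (Γ.vertex i - P)) →
      W' ∈ frontier Γ.carrier → Γ.Sees P W' → dist P W' ≤ dist P W) ∧
    w = segment ℝ (Γ.vertex i) W

/-- The union of all windows of points of `A`. -/
def windows (A : Set Pt) : Set Pt := ⋃₀ {w : Set Pt | ∃ P ∈ A, Γ.IsWindow P w}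

/-- The (interiors of the) visibility regions of the visibility decomposition of the polygon
with respect to `A`: connected components of the interior of the polygon with all windows
removed. -/
def regionInteriors (A : Set Pt) : Set (Set Pt) :=
  {R : Set Pt | ∃ x ∈ interior Γ.carrier \ Γ.windows A,
    R = connectedComponentIn (interior Γ.carrier \ Γ.windows A) x}

/-- `P` sees every point of `R`. -/
def SeesAll (P : Pt) (R : Set Pt) : Prop := ∀ x ∈ R, Γ.Sees P x

/-- `V(R)`: the set of points of `A` that see the (interior of the) region `R`. -/
def Vset (A R : Set Pt) : Set Pt := {P ∈ A | Γ.SeesAll P R}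

/-- `R` is a sink of the visibility decomposition with respect to `A`. -/
def IsSink (A R : Set Pt) : Prop :=
  R ∈ Γ.regionInteriors A ∧
  ∀ R' ∈ Γ.regionInteriors A, AdjacentRegions R R' → Γ.Vset A R ⊆ Γ.Vset A R'

end SimplePolygon

section Aux

open Topology Filter

theorem seg_sub_iff (x y : Pt) (S : Set Pt) :
    segment ℝ x y ⊆ S ↔ ∀ t ∈ Icc (0 : ℝ) 1, x + t • (y - x) ∈ S := by
  rw [segment_eq_image']
  exact image_subset_iff

theorem isOpen_seg_sub (x : Pt) {U : Set Pt} (hU : IsOpen U) :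
    IsOpen {y | segment ℝ x y ⊆ U} := by
  rw [isOpen_iff_mem_nhds]
  intro y hy
  have hy' := (seg_sub_iff x y U).1 hy
  have : ∀ᶠ z in 𝓝 y, ∀ t ∈ Icc (0 : ℝ) 1, x + t • (z - x) ∈ U := by
    apply isCompact_Icc.eventually_forall_of_forall_eventually
    intro t ht
    have hc : Continuous (fun z : Pt × ℝ => x + z.2 • (z.1 - x)) := by fun_prop
    exact hc.continuousAt.eventually (hU.mem_nhds (hy' t ht))
  filter_upwards [this] with z hz
  exact (seg_sub_iff x z U).2 hz

theorem isClosed_seg_sub (x : Pt) {K : Set Pt} (hK : IsClosed K) :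
    IsClosed {y | segment ℝ x y ⊆ K} := by
  have : {y | segment ℝ x y ⊆ K} = ⋂ t ∈ Icc (0 : ℝ) 1, {y | x + t • (y - x) ∈ K} := by
    ext y
    simp only [mem_ofPred_eq, seg_sub_iff, mem_iInter]
  rw [this]
  refine isClosed_biInter fun t _ => ?_
  exact hK.preimage (by fun_prop : Continuous fun y : Pt => x + t • (y - x))

/-- planar cross product -/
def crs (a b : Pt) : ℝ := a 0 * b 1 - a 1 * b 0

theorem continuous_crs (d a : Pt) : Continuous fun x : Pt => crs d (x - a) := by
  unfold crs
  simp only [PiLp.sub_apply]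
  fun_prop

theorem decomp (e w g : Pt) (h : crs e w ≠ 0) :
    g = (crs g w / crs e w) • e + (crs e g / crs e w) • w := by
  ext i
  have h2 := h
  simp only [PiLp.add_apply, PiLp.smul_apply, smul_eq_mul]
  rw [div_mul_eq_mul_div, div_mul_eq_mul_div, ← add_div, eq_div_iff h2]
  fin_cases i <;> simp [crs] <;> ring

theorem parallel (e w : Pt) (he : e ≠ 0) (h : crs e w = 0) : ∃ l : ℝ, w = l • e := by
  unfold crs at h
  have hpos : e 0 ≠ 0 ∨ e 1 ≠ 0 := by
    by_contra hc
    push Not at hc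
    apply he
    ext i
    fin_cases i <;> simp [hc.1, hc.2]
  rcases hpos with h0 | h0
  · refine ⟨w 0 / e 0, ?_⟩
    ext i
    fin_cases i <;> simp <;> field_simp
    linarith
  · refine ⟨w 1 / e 1, ?_⟩
    ext i
    fin_cases i <;> simp <;> field_simp
    linarith

/-- The key triangle lemma. -/
theorem tri (C K F : Set Pt) (hCo : IsOpen C) (hCK : closure C ⊆ K)
    (hhid : ∀ q ∈ C, ∀ G ∈ F, ¬ segment ℝ G q ⊆ K)
    (hsee : ∀ p ∈ closure C, p ∉ C → ∃ G ∈ F, segment ℝ G p ⊆ K)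
    (a b c : Pt) (hab : segment ℝ a b ⊆ C) (hbc : segment ℝ b c ⊆ C) :
    segment ℝ a c ⊆ C := by
  by_contra hbad
  have haC : a ∈ C := hab (left_mem_segment ℝ a b)
  have hCK' : C ⊆ K := subset_closure.trans hCK
  -- minimal bad time
  set B : Set ℝ := Icc (0 : ℝ) 1 ∩ {t | ¬ segment ℝ a (b + t • (c - b)) ⊆ C} with hB
  have hBc : IsCompact B := by
    refine isCompact_Icc.inter_right ?_
    rw [← isOpen_compl_iff]
    have : {t : ℝ | ¬ segment ℝ a (b + t • (c - b)) ⊆ C}ᶜ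
        = (fun t : ℝ => b + t • (c - b)) ⁻¹' {y | segment ℝ a y ⊆ C} := by
      ext t; simp
    rw [this]
    exact (isOpen_seg_sub a hCo).preimage (by fun_prop)
  have hBn : B.Nonempty := ⟨1, by simp, by simpa using hbad⟩
  obtain ⟨t0, ⟨ht0I, ht0⟩, hmin⟩ := hBc.exists_isLeast hBn
  have hgood : ∀ s : ℝ, 0 ≤ s → s < t0 → segment ℝ a (b + s • (c - b)) ⊆ C := by
    intro s hs0 hs
    by_contra hcon
    have := hmin (show s ∈ B from ⟨⟨hs0, hs.le.trans ht0I.2⟩, hcon⟩)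
    linarith
  have ht0pos : 0 < t0 := by
    rcases ht0I.1.lt_or_eq with h | h
    · exact h
    · exfalso; apply ht0; rw [← h]; simpa using hab
  set w := c - b with hw
  set c' := b + t0 • w with hc'
  have hc'C : c' ∈ C := (seg_sub_iff b c C).1 hbc t0 ht0I
  set e := c' - a with he
  -- minimal bad point
  set D : Set ℝ := Icc (0 : ℝ) 1 ∩ {u | a + u • e ∉ C} with hD
  have hDc : IsCompact D := by
    refine isCompact_Icc.inter_right ?_
    have : {u : ℝ | a + u • e ∉ C} = (fun u : ℝ => a + u • e) ⁻¹' Cᶜ := rfl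
    rw [this]
    exact hCo.isClosed_compl.preimage (by fun_prop)
  have hDn : D.Nonempty := by
    by_contra hcon
    apply ht0
    show segment ℝ a c' ⊆ C
    rw [seg_sub_iff]
    intro u hu
    by_contra h2
    exact hcon ⟨u, hu, h2⟩
  obtain ⟨u0, ⟨hu0I, hu0⟩, humin⟩ := hDc.exists_isLeast hDn
  have hug : ∀ u : ℝ, 0 ≤ u → u < u0 → a + u • e ∈ C := by
    intro u h0 hu
    by_contra hcon
    have := humin (show u ∈ D from ⟨⟨h0, hu.le.trans hu0I.2⟩, hcon⟩)
    linarith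
  have hu0pos : 0 < u0 := by
    rcases hu0I.1.lt_or_eq with h | h
    · exact h
    · exfalso; apply hu0; rw [← h]; simpa using haC
  have hu01 : u0 < 1 := by
    rcases hu0I.2.lt_or_eq with h | h
    · exact h
    · exfalso; apply hu0; rw [h, he]; simpa using hc'C
  set p := a + u0 • e with hp
  have htri : ∀ u s : ℝ, 0 ≤ u → u ≤ 1 → 0 < s → s ≤ t0 → a + u • e - (u * s) • w ∈ C := by
    intro u s hu0' hu1 hs0 hs1
    have h1 := (seg_sub_iff _ _ _).1 (hgood (t0 - s) (by linarith) (by linarith)) u ⟨hu0', hu1⟩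
    have h2 : a + u • (b + (t0 - s) • w - a) = a + u • e - (u * s) • w := by
      rw [he, hc']; module
    rwa [h2] at h1
  -- nondegeneracy
  have hcr : crs e w ≠ 0 := by
    intro h0
    have hene : e ≠ 0 := by
      intro h; apply hu0; show a + u0 • e ∈ C; rw [h]; simpa using haC
    obtain ⟨l, hl⟩ := parallel e w hene h0
    have hb : b = a + (1 - t0 * l) • e := by
      have : b = c' - t0 • w := by rw [hc']; module
      rw [this, hl]
      have : c' = a + e := by rw [he]; module
      rw [this]; module
    rcases le_or_gt u0 (1 - t0 * l) with h | h
    · have hpos : 0 < 1 - t0 * l := by linarith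
      have := (seg_sub_iff a b C).1 hab (u0 / (1 - t0 * l)) ⟨by positivity, by rw [div_le_one hpos]; exact h⟩
      apply hu0
      rw [hb] at this
      convert this using 1
      rw [add_sub_cancel_left, smul_smul, div_mul_cancel₀ _ hpos.ne']
    · have hlt : 0 < t0 * l := by linarith
      have := (seg_sub_iff b c C).1 hbc (t0 * ((u0 - (1 - t0 * l)) / (t0 * l)))
        ⟨mul_nonneg ht0pos.le (div_nonneg (by linarith) hlt.le), by
          have : (u0 - (1 - t0 * l)) / (t0 * l) ≤ 1 := by rw [div_le_one hlt]; linarith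
          have h3 : 0 ≤ (u0 - (1 - t0 * l)) / (t0 * l) := div_nonneg (by linarith) hlt.le
          nlinarith [ht0I.2]⟩
      apply hu0
      rw [← hw, hl, smul_smul] at this
      have h4 : t0 * ((u0 - (1 - t0 * l)) / (t0 * l)) * l = u0 - (1 - t0 * l) := by
        have : l ≠ 0 := by rintro rfl; simp at hlt
        field_simp
      rw [h4] at this
      convert this using 1
      nth_rewrite 1 [hb]
      module
  -- p is seen
  have hpcl : p ∈ closure C := by
    have hc : Continuous (fun u : ℝ => a + u • e) := by fun_prop
    have h1 : u0 ∈ closure (Ico 0 u0) := by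
      rw [closure_Ico hu0pos.ne]; exact ⟨hu0pos.le, le_rfl⟩
    refine closure_mono ?_ (image_closure_subset_closure_image hc ⟨u0, h1, rfl⟩)
    rintro _ ⟨u, hu, rfl⟩
    exact hug u hu.1 hu.2
  obtain ⟨G, hG, hGp⟩ := hsee p hpcl hu0
  have hdec := decomp e w (G - p) hcr
  set α := crs (G - p) w / crs e w
  set β := crs e (G - p) / crs e w
  have hGp' : segment ℝ p G ⊆ K := by rwa [segment_symm]
  rw [seg_sub_iff] at hGp'
  -- forward case
  have hfwd : ∀ t : ℝ, 0 ≤ t → t ≤ 1 → p + t • (G - p) ∉ C := by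
    intro t ht0' ht1 hmem
    apply hhid _ hmem G hG
    rw [segment_symm, seg_sub_iff]
    intro s hs
    have := hGp' (t + s * (1 - t)) ⟨by nlinarith [hs.1, hs.2], by nlinarith [hs.1, hs.2]⟩
    convert this using 1
    module
  have hbwd : ∀ δ : ℝ, 0 < δ → ¬ ∀ t : ℝ, 0 < t → t ≤ δ → p - t • (G - p) ∈ C := by
    intro δ hδ hall
    apply hhid _ (hall δ hδ le_rfl) G hG
    rw [segment_symm, seg_sub_iff]
    intro s hs
    rcases lt_or_ge (δ - s * (δ + 1)) 0 with h | h
    · have := hGp' (-(δ - s * (δ + 1))) ⟨by linarith, by nlinarith [hs.1, hs.2]⟩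
      convert this using 1
      module
    · rcases h.lt_or_eq with h | h
      · have := hCK' (hall _ h (by nlinarith [hs.1, hs.2]))
        convert this using 1
        module
      · have := hCK hpcl
        convert this using 1
        have h5 : p - δ • (G - p) + s • (G - (p - δ • (G - p))) = p - (δ - s * (δ + 1)) • (G - p) := by
          module
        rw [h5, ← h]; simp
  -- small u, s are fine
  have hnear : ∀ α' β' : ℝ, 0 < β' → ∃ δ : ℝ, 0 < δ ∧ δ ≤ 1 ∧ ∀ t : ℝ, 0 < t → t ≤ δ →
      p + t • (α' • e - β' • w) ∈ C := by
    intro α' β' hβ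
    obtain ⟨δ, hδ, h⟩ : ∃ δ : ℝ, 0 < δ ∧ ∀ t : ℝ, |t| < δ →
        0 < u0 + t * α' ∧ u0 + t * α' < 1 ∧ t * β' < (u0 + t * α') * t0 := by
      have h1 : ∀ᶠ t in 𝓝 (0 : ℝ), 0 < u0 + t * α' ∧ u0 + t * α' < 1 ∧
          t * β' < (u0 + t * α') * t0 := by
        refine (Filter.Eventually.and ?_ (Filter.Eventually.and ?_ ?_))
        · exact (Continuous.continuousAt (by fun_prop)).eventually_lt
            (Continuous.continuousAt (by fun_prop)) (by simpa using hu0pos)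
        · exact (Continuous.continuousAt (by fun_prop)).eventually_lt
            (Continuous.continuousAt (by fun_prop)) (by simpa using hu01)
        · exact (Continuous.continuousAt (by fun_prop)).eventually_lt
            (Continuous.continuousAt (by fun_prop)) (by simpa using mul_pos hu0pos ht0pos)
      obtain ⟨δ, hδ, h⟩ := Metric.eventually_nhds_iff.1 h1
      exact ⟨δ, hδ, fun t ht => h (by simpa [Real.dist_eq] using ht)⟩
    refine ⟨min (δ / 2) 1, by positivity, min_le_right _ _, fun t ht htδ => ?_⟩
    have htδ' : t ≤ δ / 2 := htδ.trans (min_le_left _ _)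
    obtain ⟨h1, h2, h3⟩ := h t (by rw [abs_of_pos ht]; linarith)
    have := htri (u0 + t * α') (t * β' / (u0 + t * α')) h1.le h2.le (by positivity)
      (by rw [div_le_iff₀ h1]; linarith)
    rw [mul_div_cancel₀ _ h1.ne'] at this
    convert this using 1
    rw [hp]; module
  rcases lt_trichotomy β 0 with hβ | hβ | hβ
  · obtain ⟨δ, hδ, hδ1, h⟩ := hnear α (-β) (by linarith)
    apply hfwd δ hδ.le hδ1
    have := h δ hδ le_rfl
    convert this using 1
    rw [hdec]; module
  · rw [hβ, zero_smul, add_zero] at hdec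
    rcases lt_trichotomy α 0 with hα | hα | hα
    · have hδ : 0 < min 1 (u0 / (-α)) := lt_min one_pos (div_pos hu0pos (by linarith))
      apply hfwd _ hδ.le (min_le_left _ _)
      have h2 : min 1 (u0 / (-α)) * (-α) ≤ u0 := by
        rw [← le_div_iff₀ (by linarith)]; exact min_le_right _ _
      have := hug (u0 + min 1 (u0 / (-α)) * α) (by linarith) (by nlinarith)
      convert this using 1
      rw [hdec, hp]; module
    · rw [hα, zero_smul] at hdec
      apply hhid a haC G hG
      have : G = p := sub_eq_zero.1 hdec
      rw [this, segment_symm, seg_sub_iff]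
      intro t ht
      rcases ht.2.lt_or_eq with h | h
      · have := hCK' (hug (t * u0) (mul_nonneg ht.1 hu0pos.le) (by nlinarith))
        convert this using 1
        rw [hp]; module
      · rw [h]; simpa using hCK hpcl
    · refine hbwd (u0 / α) (div_pos hu0pos hα) ?_
      intro t ht1 ht2
      rw [le_div_iff₀ hα] at ht2
      have := hug (u0 - t * α) (by linarith) (by nlinarith)
      convert this using 1
      rw [hdec, hp]; module
  · obtain ⟨δ, hδ, hδ1, h⟩ := hnear (-α) β hβ
    refine hbwd δ hδ ?_
    intro t ht1 ht2
    have := h t ht1 ht2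
    convert this using 1
    rw [hdec]; module

theorem convex_of_tri (C : Set Pt) (hCo : IsOpen C) (hCc : IsPreconnected C)
    (h : ∀ a b c : Pt, segment ℝ a b ⊆ C → segment ℝ b c ⊆ C → segment ℝ a c ⊆ C) :
    Convex ℝ C := by
  rw [convex_iff_segment_subset]
  intro a ha b hb
  have : C ⊆ {y | segment ℝ a y ⊆ C} := by
    apply hCc.subset_of_closure_inter_subset (isOpen_seg_sub a hCo)
    · exact ⟨a, ha, by simpa using ha⟩
    · rintro y ⟨hy, hyC⟩
      obtain ⟨ε, hε, hball⟩ := Metric.isOpen_iff.1 hCo y hyC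
      obtain ⟨z, hz, hzy⟩ := Metric.mem_closure_iff.1 hy ε hε
      refine h a z y hz ?_
      refine ((convex_ball y ε).segment_subset ?_ (Metric.mem_ball_self hε)).trans hball
      rw [Metric.mem_ball, dist_comm]; exact hzy
  exact this hb

end Aux

section Aux2

open Topology Filter

theorem vper (Γ : SimplePolygon) {i j : ℤ} (h : (Γ.n : ℤ) ∣ j - i) :
    Γ.vertex j = Γ.vertex i := by
  obtain ⟨k, hk⟩ := h
  have hp : Function.Periodic Γ.vertex (Γ.n : ℤ) := Γ.periodic
  have h2 := hp.int_mul k i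
  have : j = i + k * (Γ.n : ℤ) := by linarith
  rw [this]
  simpa using h2

theorem dvd_mod (Γ : SimplePolygon) (i : ℤ) : (Γ.n : ℤ) ∣ i % Γ.n - i := by
  rw [Int.emod_def]
  exact ⟨-(i / Γ.n), by ring⟩

theorem frontier_edge (Γ : SimplePolygon) {p : Pt} (hp : p ∈ frontier Γ.carrier) :
    ∃ i ∈ Finset.Ico (0 : ℤ) Γ.n, p ∈ segment ℝ (Γ.vertex i) (Γ.vertex (i + 1)) := by
  rw [Γ.boundary_eq] at hp
  obtain ⟨i, hi⟩ := mem_iUnion.1 hp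
  have hn : (0 : ℤ) < Γ.n := by have := Γ.three_le; omega
  refine ⟨i % Γ.n, ?_, ?_⟩
  · rw [Finset.mem_Ico]
    exact ⟨Int.emod_nonneg _ hn.ne', Int.emod_lt_of_pos _ hn⟩
  · have h := dvd_mod Γ i
    rw [vper Γ h, vper Γ (i := i + 1) (j := i % Γ.n + 1) (by simpa using h)]
    exact hi

theorem vertex_ne (Γ : SimplePolygon) {i : ℤ} (hi : i ∈ Finset.Ico (0 : ℤ) Γ.n) :
    Γ.vertex (i + 1) - Γ.vertex i ≠ 0 := by
  rw [Finset.mem_Ico] at hi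
  have hn := Γ.three_le
  intro h
  have h := sub_eq_zero.1 h
  by_cases h1 : i + 1 < Γ.n
  · have := Γ.vertex_inj _ _ (by omega) h1 hi.1 hi.2 h
    omega
  · have h2 : i + 1 = 0 + Γ.n := by omega
    rw [h2, Γ.periodic] at h
    have := Γ.vertex_inj _ _ le_rfl (by omega) hi.1 hi.2 h
    omega

theorem sub_interior (Γ : SimplePolygon) {S : Set Pt} (hS : IsPreconnected S)
    (hf : ∀ x ∈ S, x ∉ frontier Γ.carrier) (hne : (S ∩ Γ.carrier).Nonempty) :
    S ⊆ interior Γ.carrier := by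
  have key : ∀ x ∈ S, x ∈ Γ.carrier → x ∈ interior Γ.carrier := by
    intro x hx hxc
    by_contra hcon
    exact hf x hx ⟨subset_closure hxc, hcon⟩
  apply hS.subset_of_closure_inter_subset isOpen_interior
  · obtain ⟨x, hx, hxc⟩ := hne
    exact ⟨x, hx, key x hx hxc⟩
  · rintro x ⟨hx, hxS⟩
    refine key x hxS ?_
    rw [Γ.regular]; exact hx

theorem edge_local (Γ : SimplePolygon) (i : ℤ) (r : Pt)
    (hr : r ∈ segment ℝ (Γ.vertex i) (Γ.vertex (i + 1))) (hv : ∀ j, r ≠ Γ.vertex j) :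
    ∀ᶠ x in 𝓝 r, x ∈ frontier Γ.carrier →
      x ∈ segment ℝ (Γ.vertex i) (Γ.vertex (i + 1)) := by
  have h1 : ∀ᶠ x in 𝓝 r, ∀ j ∈ Finset.Ico (0 : ℤ) Γ.n,
      x ∈ segment ℝ (Γ.vertex j) (Γ.vertex (j + 1)) →
      x ∈ segment ℝ (Γ.vertex i) (Γ.vertex (i + 1)) := by
    rw [eventually_all_finset]
    intro j _
    by_cases hd : (Γ.n : ℤ) ∣ j - i
    · rw [vper Γ hd, vper Γ (i := i + 1) (j := j + 1) (by simpa using hd)]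
      exact Eventually.of_forall fun x hx => hx
    · have hrj : r ∉ segment ℝ (Γ.vertex j) (Γ.vertex (j + 1)) := by
        intro hrj
        by_cases h2 : (Γ.n : ℤ) ∣ j - (i + 1)
        · have h3 := Γ.adj_edges i j h2 hd
          have : r ∈ ({Γ.vertex j} : Set Pt) := h3 ▸ ⟨hr, hrj⟩
          exact hv j this
        · by_cases h4 : (Γ.n : ℤ) ∣ i - (j + 1)
          · have h3 := Γ.adj_edges j i h4 (by rwa [dvd_sub_comm])
            have : r ∈ ({Γ.vertex i} : Set Pt) := h3 ▸ ⟨hrj, hr⟩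
            exact hv i this
          · exact disjoint_left.1 (Γ.nonadj_edges i j hd h2 h4) hr hrj
      have hcl : IsClosed (segment ℝ (Γ.vertex j) (Γ.vertex (j + 1))) := by
        rw [segment_eq_image']
        exact (isCompact_Icc.image (by fun_prop)).isClosed
      filter_upwards [hcl.isOpen_compl.mem_nhds hrj] with x hx hx2
      exact absurd hx2 hx
  filter_upwards [h1] with x hx hxf
  obtain ⟨j, hj, hxj⟩ := frontier_edge Γ hxf
  exact hx j hj hxj

theorem crs_line (d a x y : Pt) (t : ℝ) :
    crs d (x + t • (y - x) - a) = (1 - t) * crs d (x - a) + t * crs d (y - a) := by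
  simp [crs]; ring

theorem crs_edge {a b x : Pt} (h : x ∈ segment ℝ a b) : crs (b - a) (x - a) = 0 := by
  rw [segment_eq_image'] at h
  obtain ⟨t, _, rfl⟩ := h
  simp [crs]; ring

theorem transv (Γ : SimplePolygon) (G p : Pt) (hs : Γ.Sees G p)
    (h1 : ∀ j, crs (Γ.vertex (j + 1) - Γ.vertex j) (p - Γ.vertex j) ≠ 0)
    (h2 : ∀ j, Γ.vertex j ≠ G → crs (Γ.vertex j - G) (p - G) ≠ 0)
    (i : ℤ) (hG : G ∉ segment ℝ (Γ.vertex i) (Γ.vertex (i + 1)))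
    (r : Pt) (hrs : r ∈ segment ℝ G p)
    (hr : r ∈ segment ℝ (Γ.vertex i) (Γ.vertex (i + 1))) : False := by
  have hrf : r ∈ frontier Γ.carrier := by
    rw [Γ.boundary_eq]; exact mem_iUnion.2 ⟨i, hr⟩
  have hr0 := crs_edge hr
  have hrs' := hrs
  rw [segment_eq_image'] at hrs'
  obtain ⟨t, ht, rfl⟩ := hrs'
  simp only at hrs hr hrf hr0
  have hsees := (seg_sub_iff _ _ _).1 hs
  set d := Γ.vertex (i + 1) - Γ.vertex i with hd
  set v := Γ.vertex i with hv
  have ht0 : t ≠ 0 := by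
    rintro rfl
    apply hG; simpa using hr
  have ht1 : t ≠ 1 := by
    rintro rfl
    apply h1 i; simpa using hr0
  have ht0' : 0 < t := lt_of_le_of_ne ht.1 ht0.symm
  have ht1' : t < 1 := lt_of_le_of_ne ht.2 ht1
  have hvert : ∀ j, G + t • (p - G) ≠ Γ.vertex j := by
    intro j hj
    have hne : Γ.vertex j ≠ G := by
      intro h; apply hG; rw [← h, ← hj]; exact hr
    apply h2 j hne
    rw [← hj]
    simp [crs]; ring
  have hpd : crs d (p - v) ≠ 0 := h1 i
  rw [crs_line] at hr0
  -- the product of the signs is negative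
  obtain ⟨ε, hε, hball⟩ := Metric.eventually_nhds_iff_ball.1 (edge_local Γ i _ hr hvert)
  set r := G + t • (p - G) with hrdef
  have hrv : crs d (r - v) = 0 := by rw [hrdef, crs_line]; exact hr0
  have hline : ∀ (x : Pt) (s : ℝ), crs d (x + s • (p - G) - v)
      = crs d (x - v) + s * (crs d (p - v) - crs d (G - v)) := by
    intro x s; simp [crs]; ring
  set m := crs d (p - v) - crs d (G - v) with hm
  have hmne : m ≠ 0 := by
    intro h0
    apply hpd
    have : crs d (p - v) = crs d (G - v) := by linarith
    rw [this] at hr0 ⊢; linarith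
  have hhalf : ∀ σ : ℝ, σ ≠ 0 → Metric.ball r ε ∩ {x | 0 < σ * crs d (x - v)} ⊆
      interior Γ.carrier := by
    intro σ hσ
    apply sub_interior
    · apply Convex.isPreconnected
      refine (convex_ball r ε).inter ?_
      rw [convex_iff_segment_subset]
      intro x hx y hy
      rw [seg_sub_iff]
      intro s hs
      simp only [mem_ofPred_eq] at hx hy ⊢
      rw [crs_line]
      rcases hs.1.lt_or_eq with h | h
      · nlinarith [mul_pos h hy, mul_nonneg (sub_nonneg.2 hs.2) hx.le]
      · rw [← h]; simpa using hx
    · rintro x ⟨hxb, hx⟩ hxf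
      have := crs_edge (hball x hxb hxf)
      simp only [mem_ofPred_eq] at hx
      rw [← hd, ← hv] at this
      rw [this] at hx
      simp at hx
    · -- a point of the sight segment
      have hev : ∀ᶠ s in 𝓝 (0 : ℝ), r + (s * (σ * m)) • (p - G) ∈ Metric.ball r ε ∧
          t + s * (σ * m) ∈ Ioo (0 : ℝ) 1 := by
        refine Eventually.and ?_ ?_
        · have hc : Continuous fun s : ℝ => r + (s * (σ * m)) • (p - G) := by fun_prop
          exact hc.continuousAt.eventually_mem (by simpa only [zero_mul, zero_smul, add_zero] using Metric.ball_mem_nhds r hε)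
        · have hc : Continuous fun s : ℝ => t + s * (σ * m) := by fun_prop
          exact hc.continuousAt.eventually_mem (by simpa only [zero_mul, add_zero] using Ioo_mem_nhds ht0' ht1')
      have hev2 : ∀ᶠ s in 𝓝[>] (0 : ℝ), 0 < s := self_mem_nhdsWithin
      obtain ⟨s, ⟨hs1, hs2⟩, hs0⟩ := ((hev.filter_mono nhdsWithin_le_nhds).and hev2).exists
      refine ⟨_, ⟨hs1, ?_⟩, ?_⟩
      · simp only [mem_ofPred_eq]
        rw [hline, hrv]
        have : 0 < s * (σ * m) ^ 2 := by positivity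
        nlinarith
      · have := hsees (t + s * (σ * m)) ⟨hs2.1.le, hs2.2.le⟩
        convert this using 1
        rw [hrdef]; module
  have hsub : Metric.ball r ε ⊆ Γ.carrier := by
    intro x hx
    have hpos : ∀ y ∈ Metric.ball r ε, crs d (y - v) ≠ 0 → y ∈ interior Γ.carrier := by
      intro y hy hy0
      exact hhalf (crs d (y - v)) hy0 ⟨hy, by simp only [mem_ofPred_eq]; exact mul_self_pos.2 hy0⟩
    by_cases hx0 : crs d (x - v) = 0
    · rw [Γ.regular]
      have hc : Continuous fun s : ℝ => x + s • (p - G) := by fun_prop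
      have h5 : ∀ᶠ s in 𝓝[>] (0 : ℝ), x + s • (p - G) ∈ interior Γ.carrier := by
        have h6 : ∀ᶠ s in 𝓝 (0 : ℝ), x + s • (p - G) ∈ Metric.ball r ε :=
          hc.continuousAt.eventually_mem (by simpa only [zero_smul, add_zero] using Metric.isOpen_ball.mem_nhds hx)
        filter_upwards [h6.filter_mono nhdsWithin_le_nhds, self_mem_nhdsWithin] with s hs hs0
        apply hpos _ hs
        rw [hline, hx0, zero_add]
        exact mul_ne_zero (ne_of_gt hs0) hmne
      have h7 : Tendsto (fun s : ℝ => x + s • (p - G)) (𝓝[>] 0) (𝓝 x) := by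
        have := (hc.tendsto 0).mono_left (nhdsWithin_le_nhds (s := Ioi 0))
        simpa using this
      exact mem_closure_of_tendsto h7 h5
    · exact interior_subset (hpos x hx hx0)
  exact hrf.2 (mem_interior.2 ⟨_, hsub, Metric.isOpen_ball, Metric.mem_ball_self hε⟩)

theorem sees_nhds (Γ : SimplePolygon) (G p : Pt) (hGc : G ∈ Γ.carrier) (hs : Γ.Sees G p)
    (hpi : p ∈ interior Γ.carrier)
    (h1 : ∀ j, crs (Γ.vertex (j + 1) - Γ.vertex j) (p - Γ.vertex j) ≠ 0)
    (h2 : ∀ j, Γ.vertex j ≠ G → crs (Γ.vertex j - G) (p - G) ≠ 0) :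
    ∀ᶠ q in 𝓝 p, Γ.Sees G q := by
  have h3 : ∀ᶠ q in 𝓝 p, ∀ j ∈ Finset.Ico (0 : ℤ) Γ.n, ∀ t : ℝ, 0 < t → t ≤ 1 →
      G + t • (q - G) ∉ segment ℝ (Γ.vertex j) (Γ.vertex (j + 1)) := by
    rw [eventually_all_finset]
    intro j _
    by_cases hG : G ∈ segment ℝ (Γ.vertex j) (Γ.vertex (j + 1))
    · have hG0 := crs_edge hG
      have : ∀ᶠ q in 𝓝 p, crs (Γ.vertex (j + 1) - Γ.vertex j) (q - Γ.vertex j) ≠ 0 :=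
        (continuous_crs _ _).continuousAt.eventually_ne (h1 j)
      filter_upwards [this] with q hq t ht _ hmem
      have h5 := crs_edge hmem
      rw [crs_line, hG0, mul_zero, zero_add] at h5
      exact hq ((mul_eq_zero.1 h5).resolve_left ht.ne')
    · have hcl : IsClosed (segment ℝ (Γ.vertex j) (Γ.vertex (j + 1))) := by
        rw [segment_eq_image']
        exact (isCompact_Icc.image (by fun_prop)).isClosed
      have hp : segment ℝ G p ⊆ (segment ℝ (Γ.vertex j) (Γ.vertex (j + 1)))ᶜ :=
        fun r hr hr2 => transv Γ G p hs h1 h2 j hG r hr hr2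
      filter_upwards [(isOpen_seg_sub G hcl.isOpen_compl).mem_nhds hp] with q hq t ht0 ht1
      exact (seg_sub_iff _ _ _).1 hq t ⟨ht0.le, ht1⟩
  filter_upwards [h3, isOpen_interior.mem_nhds hpi] with q hq hqi
  have h4 : (fun t : ℝ => G + t • (q - G)) '' Ioc 0 1 ⊆ interior Γ.carrier := by
    apply sub_interior
    · exact isPreconnected_Ioc.image _ (by fun_prop)
    · rintro _ ⟨t, ht, rfl⟩ hf
      obtain ⟨j, hj, hmem⟩ := frontier_edge Γ hf
      exact hq j hj t ht.1 ht.2 hmem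
    · exact ⟨q, ⟨1, by simp, by simp⟩, interior_subset hqi⟩
  unfold SimplePolygon.Sees
  rw [seg_sub_iff]
  intro t ht
  rcases ht.1.lt_or_eq with h | h
  · exact interior_subset (h4 ⟨t, ⟨h, ht.2⟩, rfl⟩)
  · rw [← h]; simpa using hGc

theorem extreme_line (K : Set Pt) (hK : IsCompact K) (d a : Pt) (hd : d ≠ 0) :
    (K.extremePoints ℝ ∩ {x | crs d (x - a) = 0}).Finite := by
  set S := K ∩ {x | crs d (x - a) = 0} with hS
  have hSc : IsCompact S :=
    hK.inter_right (isClosed_singleton.preimage (continuous_crs d a) : IsClosed _)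
  rcases S.eq_empty_or_nonempty with he | hne
  · refine Set.Finite.subset Set.finite_empty ?_
    rintro x ⟨hx, hx2⟩
    rw [← he]; exact ⟨hx.1, hx2⟩
  have hdpos : 0 < d 0 ^ 2 + d 1 ^ 2 := by
    by_contra hcon
    apply hd
    have h0 : d 0 = 0 := by nlinarith [sq_nonneg (d 0), sq_nonneg (d 1)]
    have h1 : d 1 = 0 := by nlinarith [sq_nonneg (d 0), sq_nonneg (d 1)]
    ext i
    fin_cases i <;> simp [h0, h1]
  set g : Pt → ℝ := fun x => (d 0 * (x 0 - a 0) + d 1 * (x 1 - a 1)) / (d 0 ^ 2 + d 1 ^ 2) with hg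
  have hgc : Continuous g := by
    rw [hg]; fun_prop
  have hpar : ∀ x, crs d (x - a) = 0 → x = a + g x • d := by
    intro x hx
    simp only [crs, PiLp.sub_apply] at hx
    ext i
    simp only [hg, PiLp.add_apply, PiLp.smul_apply, smul_eq_mul]
    rw [div_mul_eq_mul_div, ← sub_eq_iff_eq_add', eq_div_iff hdpos.ne']
    fin_cases i
    · simp; linear_combination (-d 1) * hx
    · simp; linear_combination (d 0) * hx
  obtain ⟨m, hmS, hm⟩ := hSc.exists_isMinOn hne hgc.continuousOn
  obtain ⟨M, hMS, hM⟩ := hSc.exists_isMaxOn hne hgc.continuousOn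
  refine Set.Finite.subset (Set.toFinite {m, M}) ?_
  rintro x ⟨hx, hx2⟩
  have hxS : x ∈ S := ⟨hx.1, hx2⟩
  have h1 : g m ≤ g x := hm hxS
  have h2 : g x ≤ g M := hM hxS
  have hseg : x ∈ segment ℝ m M := by
    rw [hpar x hx2, hpar m hmS.2, hpar M hMS.2, segment_eq_image']
    rcases eq_or_lt_of_le (h1.trans h2) with h | h
    · refine ⟨0, by simp, ?_⟩
      have : g m = g x := by linarith
      simp [this]
    · have hpos : 0 < g M - g m := by linarith
      refine ⟨(g x - g m) / (g M - g m), ⟨div_nonneg (by linarith) hpos.le, ?_⟩, ?_⟩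
      · rw [div_le_one hpos]; linarith
      · have h9 : a + g M • d - (a + g m • d) = (g M - g m) • d := by module
        simp only [h9, smul_smul, div_mul_cancel₀ _ hpos.ne']
        module
  have := (mem_extremePoints_iff_forall_segment.1 hx).2 m hmS.1 M hMS.1 hseg
  rcases this with h | h
  · left; exact h.symm
  · right; exact h.symm

end Aux2

/-- the closure of every connected component of the hidden region is a
convex polygon. -/
theorem closure_component_convex_polygon (Γ : SimplePolygon) (F : Set Pt) (hF : F ⊆ Γ.carrier) (hFfin : F.Finite)
    (hwalls : Γ.Covers F (frontier Γ.carrier)) (hnotall : ¬ Γ.Covers F Γ.carrier)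
    (x : Pt) (hx : x ∈ Γ.Hidden F) :
    Convex ℝ (closure (connectedComponentIn (Γ.Hidden F) x)) ∧
    ∃ V : Finset Pt,
      closure (connectedComponentIn (Γ.Hidden F) x) = convexHull ℝ (V : Set Pt) := by
  have hKc : IsClosed Γ.carrier := Γ.compact.isClosed
  have hRo : IsOpen (Γ.Hidden F) := by
    have : Γ.Hidden F = interior Γ.carrier ∩ (⋃ G ∈ F, {A | segment ℝ G A ⊆ Γ.carrier})ᶜ := by
      ext A
      constructor
      · rintro ⟨hA, hA2⟩
        refine ⟨?_, ?_⟩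
        · by_contra hcon
          obtain ⟨G, hG, hs⟩ := hwalls A ⟨subset_closure hA, hcon⟩
          exact hA2 G hG hs
        · intro hm
          simp only [mem_iUnion] at hm
          obtain ⟨G, hG, hs⟩ := hm
          exact hA2 G hG hs
      · rintro ⟨hA, hA2⟩
        refine ⟨interior_subset hA, fun G hG hs => hA2 ?_⟩
        simp only [mem_iUnion]
        exact ⟨G, hG, hs⟩
    rw [this]
    exact isOpen_interior.inter
      (hFfin.isClosed_biUnion fun G _ => isClosed_seg_sub G hKc).isOpen_compl
  set C := connectedComponentIn (Γ.Hidden F) x with hC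
  have hCo : IsOpen C := hRo.connectedComponentIn
  have hCR : C ⊆ Γ.Hidden F := connectedComponentIn_subset _ _
  have hCK : closure C ⊆ Γ.carrier :=
    closure_minimal (fun y hy => (hCR hy).1) hKc
  have hnR : ∀ p ∈ closure C, p ∉ C → p ∉ Γ.Hidden F := by
    intro p hp hpC hpR
    have ho : IsOpen (connectedComponentIn (Γ.Hidden F) p) := hRo.connectedComponentIn
    obtain ⟨y, hy1, hy2⟩ := mem_closure_iff.1 hp _ ho (mem_connectedComponentIn hpR)
    apply hpC
    rw [hC, connectedComponentIn_eq hy2, ← connectedComponentIn_eq hy1]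
    exact mem_connectedComponentIn hpR
  have hsee : ∀ p ∈ closure C, p ∉ C → ∃ G ∈ F, segment ℝ G p ⊆ Γ.carrier := by
    intro p hp hpC
    by_contra hcon
    push Not at hcon
    exact hnR p hp hpC ⟨hCK hp, hcon⟩
  have hhid : ∀ q ∈ C, ∀ G ∈ F, ¬ segment ℝ G q ⊆ Γ.carrier := fun q hq => (hCR hq).2
  have hconv : Convex ℝ C := convex_of_tri C hCo isPreconnected_connectedComponentIn
    (fun a b c => tri C Γ.carrier F hCo hCK hhid hsee a b c)
  have hcc : Convex ℝ (closure C) := hconv.closure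
  have hcomp : IsCompact (closure C) := Γ.compact.of_isClosed_subset isClosed_closure hCK
  refine ⟨hcc, ?_⟩
  have hfin : ((closure C).extremePoints ℝ).Finite := by
    have hf1 : (⋃ j ∈ Finset.Ico (0 : ℤ) Γ.n, (closure C).extremePoints ℝ ∩
        {y | crs (Γ.vertex (j + 1) - Γ.vertex j) (y - Γ.vertex j) = 0}).Finite :=
      Set.Finite.biUnion (Finset.finite_toSet _) fun j hj =>
        extreme_line _ hcomp _ _ (vertex_ne Γ hj)
    have hf2 : (⋃ G ∈ F, ⋃ j ∈ {j ∈ (Finset.Ico (0 : ℤ) Γ.n : Set ℤ) | Γ.vertex j ≠ G},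
        (closure C).extremePoints ℝ ∩
        {y | crs (Γ.vertex j - G) (y - G) = 0}).Finite :=
      hFfin.biUnion fun G _ => Set.Finite.biUnion
        ((Finset.finite_toSet _).subset (sep_subset _ _)) fun j hj =>
          extreme_line _ hcomp _ _ (sub_ne_zero.2 hj.2)
    refine (hf1.union hf2).subset ?_
    intro p hp
    by_contra hcon
    have hpcl : p ∈ closure C := hp.1
    have hpC : p ∉ C := fun h =>
      disjoint_left.1 (disjoint_interior_extremePoints (closure C))
        (interior_maximal subset_closure hCo h) hp
    obtain ⟨G, hG, hs⟩ := hsee p hpcl hpC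
    have hn : (0 : ℤ) < Γ.n := by have := Γ.three_le; omega
    have hmod : ∀ j : ℤ, j % Γ.n ∈ Finset.Ico (0 : ℤ) Γ.n := fun j => by
      rw [Finset.mem_Ico]
      exact ⟨Int.emod_nonneg _ hn.ne', Int.emod_lt_of_pos _ hn⟩
    have h1 : ∀ j, crs (Γ.vertex (j + 1) - Γ.vertex j) (p - Γ.vertex j) ≠ 0 := by
      intro j h0
      have h := dvd_mod Γ j
      apply hcon
      left
      simp only [mem_iUnion]
      refine ⟨j % Γ.n, hmod j, hp, ?_⟩
      simp only [mem_ofPred_eq]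
      rw [vper Γ h, vper Γ (i := j + 1) (j := j % Γ.n + 1) (by simpa using h)]
      exact h0
    have h2 : ∀ j, Γ.vertex j ≠ G → crs (Γ.vertex j - G) (p - G) ≠ 0 := by
      intro j hj h0
      have h := dvd_mod Γ j
      apply hcon
      right
      simp only [mem_iUnion]
      refine ⟨G, hG, j % Γ.n, ⟨hmod j, by rw [vper Γ h]; exact hj⟩, hp, ?_⟩
      simp only [mem_ofPred_eq]
      rw [vper Γ h]
      exact h0
    have hpi : p ∈ interior Γ.carrier := by
      by_contra hni
      obtain ⟨i, _, hmem⟩ := frontier_edge Γ ⟨subset_closure (hCK hpcl), hni⟩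
      exact h1 i (crs_edge hmem)
    have hnear := sees_nhds Γ G p (hF hG) hs hpi h1 h2
    obtain ⟨q, hq1, hq2⟩ := mem_closure_iff_nhds.1 hpcl _ hnear
    exact hhid q hq2 G hG hq1
  refine ⟨hfin.toFinset, ?_⟩
  rw [Set.Finite.coe_toFinset]
  have := closure_convexHull_extremePoints hcomp hcc
  rw [(hfin.isClosed_convexHull ℝ).closure_eq] at this
  exact this.symm
end
end

section
/- If the boundary of a simple polygon Γ is covered by the views of at most two guards, then these guards cover all of Γ. -/
open Set

noncomputable section

namespace TG

lemma seg_line (P u : Pt) (s t : ℝ) :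
    segment ℝ (P + s • u) (P + t • u) = (fun r : ℝ => P + r • u) '' Set.uIcc s t := by
  have h := image_segment ℝ (AffineMap.lineMap P (P + u) : ℝ →ᵃ[ℝ] Pt) s t
  rw [segment_eq_uIcc] at h
  have e : ∀ r : ℝ, (AffineMap.lineMap P (P + u) : ℝ →ᵃ[ℝ] Pt) r = P + r • u := by
    intro r
    simp [AffineMap.lineMap_apply, add_comm]
  simp only [e] at h
  exact h.symm

lemma collinear_sees {K : Set Pt} (P u : Pt) (s t : ℝ)
    (h1 : segment ℝ (P + s • u) (P + t • u) ⊆ K) (h2 : segment ℝ P (P + t • u) ⊆ K) :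
    segment ℝ (P + s • u) P ⊆ K := by
  have e0 : P = P + (0 : ℝ) • u := by simp
  have h2' : segment ℝ (P + (0 : ℝ) • u) (P + t • u) ⊆ K := by rwa [← e0]
  have goal' : segment ℝ (P + s • u) (P + (0 : ℝ) • u) ⊆ K := by
    rw [seg_line] at *
    rintro _ ⟨r, hr, rfl⟩
    have : r ∈ Set.uIcc s t ∨ r ∈ Set.uIcc 0 t := by
      simp only [Set.mem_uIcc] at *
      grind
    rcases this with h | h
    · exact h1 ⟨r, h, rfl⟩
    · exact h2' ⟨r, h, rfl⟩
  rwa [← e0] at goal'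

def det (p q : Pt) : ℝ := p 0 * q 1 - p 1 * q 0

lemma ray_hit (K : Set Pt) (hK : IsCompact K) (P u : Pt) (hP : P ∈ K) (hu : u ≠ 0) :
    ∃ t : ℝ, 0 ≤ t ∧ P + t • u ∈ frontier K ∧ segment ℝ P (P + t • u) ⊆ K := by
  have hcont : Continuous (fun t : ℝ => P + t • u) := by fun_prop
  set Z : Set ℝ := {t | 0 ≤ t ∧ P + t • u ∉ interior K} with hZ
  have hZc : IsClosed Z := by
    have : Z = Set.Ici 0 ∩ (fun t : ℝ => P + t • u) ⁻¹' (interior K)ᶜ := by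
      ext t; simp [hZ]
    rw [this]
    exact isClosed_Ici.inter (isOpen_interior.isClosed_compl.preimage hcont)
  have hZn : Z.Nonempty := by
    obtain ⟨R, hR⟩ := hK.isBounded.exists_norm_le
    have hu' : 0 < ‖u‖ := norm_pos_iff.2 hu
    refine ⟨(|R| + 1 + ‖P‖) / ‖u‖, by positivity, fun hin => ?_⟩
    have h1 := hR _ (interior_subset hin)
    have h2 : ‖((|R| + 1 + ‖P‖) / ‖u‖) • u‖ = |R| + 1 + ‖P‖ := by
      rw [norm_smul, Real.norm_of_nonneg (by positivity)]
      field_simp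
    have h3 : ‖((|R| + 1 + ‖P‖) / ‖u‖) • u‖ ≤ ‖P + ((|R| + 1 + ‖P‖) / ‖u‖) • u‖ + ‖P‖ := by
      have := norm_sub_le (P + ((|R| + 1 + ‖P‖) / ‖u‖) • u) P
      simpa using this
    linarith [le_abs_self R]
  have hbdd : BddBelow Z := ⟨0, fun t ht => ht.1⟩
  have hm : sInf Z ∈ Z := hZc.csInf_mem hZn hbdd
  set m := sInf Z with hmdef
  have hlt : ∀ t, 0 ≤ t → t < m → P + t • u ∈ interior K := by
    intro t ht htm
    by_contra hc
    exact absurd (csInf_le hbdd (show t ∈ Z from ⟨ht, hc⟩)) (not_le.2 htm)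
  have hmK : P + m • u ∈ K := by
    rcases eq_or_lt_of_le hm.1 with h | h
    · rw [← h]; simpa using hP
    · have hcl : m ∈ closure (Set.Ico 0 m) := by
        rw [closure_Ico h.ne]; exact ⟨hm.1, le_rfl⟩
      have := map_mem_closure hcont hcl (t := K)
        (fun t ht => interior_subset (hlt t ht.1 ht.2))
      rwa [hK.isClosed.closure_eq] at this
  refine ⟨m, hm.1, ?_, ?_⟩
  · rw [hK.isClosed.frontier_eq]; exact ⟨hmK, hm.2⟩
  · have e0 : P = P + (0 : ℝ) • u := by simp
    have : segment ℝ (P + (0 : ℝ) • u) (P + m • u) ⊆ K := by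
      rw [seg_line, Set.uIcc_of_le hm.1]
      rintro _ ⟨r, hr, rfl⟩
      rcases eq_or_lt_of_le hr.2 with h | h
      · rw [h]; exact hmK
      · exact interior_subset (hlt r hr.1 h)
    rwa [← e0] at this

lemma det_cont1 (b x : Pt) : Continuous (fun y : Pt => det (y - x) b) := by
  unfold det; fun_prop

lemma det_cont2 (a x : Pt) : Continuous (fun y : Pt => det a (y - x)) := by
  unfold det; fun_prop

lemma convex_half (a x : Pt) : Convex ℝ {y : Pt | 0 < det a (y - x)} := by
  intro y hy z hz s t hs ht hst
  simp only [Set.mem_ofPred_eq, det, PiLp.add_apply, PiLp.sub_apply, PiLp.smul_apply,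
    smul_eq_mul] at *
  obtain rfl : t = 1 - s := by linarith
  rcases eq_or_lt_of_le hs with h | h
  · subst h; linarith
  · nlinarith

lemma det_neg (a y : Pt) : det (-a) y = - det a y := by
  simp [det]; ring

lemma det_swap (a y : Pt) : det y a = - det a y := by
  simp [det]; ring

lemma det_add_smul (a x w : Pt) (t : ℝ) : det a (x + t • w - x) = t * det a w := by
  simp [det]; ring

lemma det_self (a : Pt) : det a a = 0 := by
  simp [det]; ring

lemma exists_smul_of_det (a y : Pt) (ha : a ≠ 0) (h : det a y = 0) : ∃ c : ℝ, y = c • a := by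
  have hne : a 0 * a 0 + a 1 * a 1 ≠ 0 := by
    intro h0
    apply ha
    ext i
    fin_cases i
    · simp; nlinarith [mul_self_nonneg (a 0), mul_self_nonneg (a 1)]
    · simp; nlinarith [mul_self_nonneg (a 0), mul_self_nonneg (a 1)]
  refine ⟨(a 0 * y 0 + a 1 * y 1) / (a 0 * a 0 + a 1 * a 1), ?_⟩
  unfold det at h
  ext i
  fin_cases i
  · simp only [Fin.zero_eta, PiLp.smul_apply, smul_eq_mul]
    rw [div_mul_eq_mul_div, eq_div_iff hne]; linear_combination (- a 1) * h
  · simp only [Fin.mk_one, PiLp.smul_apply, smul_eq_mul]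
    rw [div_mul_eq_mul_div, eq_div_iff hne]; linear_combination (a 0) * h

lemma sector_aux (a b x : Pt) (r : ℝ) (hr : 0 < r) (ha : a ≠ 0) (hb : b ≠ 0)
    (hD : 0 < det a b) :
    ∃ S1 S2 : Set Pt, IsPreconnected S1 ∧ IsPreconnected S2 ∧
      S1 ⊆ Metric.ball x r ∧ S2 ⊆ Metric.ball x r ∧
      (∀ y ∈ Metric.ball x r, y ∈ S1 ∨ y ∈ S2 ∨ (∃ t : ℝ, 0 ≤ t ∧ y = x + t • a) ∨
        ∃ t : ℝ, 0 ≤ t ∧ y = x + t • b) ∧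
      (∀ y, y ∈ S1 ∨ y ∈ S2 → ∀ t : ℝ, 0 ≤ t → y ≠ x + t • a ∧ y ≠ x + t • b) := by
  have hball : Convex ℝ (Metric.ball x r) := convex_ball x r
  refine ⟨Metric.ball x r ∩ ({y | 0 < det a (y - x)} ∩ {y | 0 < det (-b) (y - x)}),
    (Metric.ball x r ∩ {y | 0 < det (-a) (y - x)}) ∪ (Metric.ball x r ∩ {y | 0 < det b (y - x)}),
    ?_, ?_, inter_subset_left, union_subset inter_subset_left inter_subset_left, ?_, ?_⟩
  · exact (hball.inter ((convex_half a x).inter (convex_half (-b) x))).isPreconnected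
  · have hn : 0 < ‖a + b‖ + 1 := by positivity
    set ε := r / (‖a + b‖ + 1) with hε
    have hεp : 0 < ε := by positivity
    have hz : x + ε • (-a - b) ∈ Metric.ball x r := by
      rw [mem_ball_iff_norm, add_sub_cancel_left, norm_smul, Real.norm_of_nonneg hεp.le,
        show -a - b = -(a + b) by abel, norm_neg, hε, div_mul_eq_mul_div, div_lt_iff₀ hn]
      nlinarith
    refine IsPreconnected.union (x + ε • (-a - b)) ⟨hz, ?_⟩ ⟨hz, ?_⟩
      (hball.inter (convex_half (-a) x)).isPreconnected
      (hball.inter (convex_half b x)).isPreconnected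
    · simp only [Set.mem_ofPred_eq, det_add_smul]
      apply mul_pos hεp
      simp only [det, PiLp.sub_apply, PiLp.neg_apply] at *; linarith
    · simp only [Set.mem_ofPred_eq, det_add_smul]
      apply mul_pos hεp
      simp only [det, PiLp.sub_apply, PiLp.neg_apply] at *; linarith
  · intro y hy
    simp only [Set.mem_inter_iff, hy, true_and, Set.mem_union, Set.mem_ofPred_eq, det_neg]
    by_cases h1 : det a (y - x) < 0
    · right; left; left; linarith
    by_cases h2 : 0 < det b (y - x)
    · right; left; right; exact h2
    by_cases h3 : det a (y - x) = 0
    · right; right; left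
      obtain ⟨c, hc⟩ := exists_smul_of_det a (y - x) ha h3
      refine ⟨c, ?_, by rw [← hc]; abel⟩
      rw [hc] at h2
      have : det b (c • a) = - (c * det a b) := by simp [det]; ring
      rw [this] at h2
      by_contra hneg
      push Not at hneg
      nlinarith
    by_cases h4 : det b (y - x) = 0
    · right; right; right
      obtain ⟨c, hc⟩ := exists_smul_of_det b (y - x) hb h4
      refine ⟨c, ?_, by rw [← hc]; abel⟩
      rw [hc] at h1
      have : det a (c • b) = (c * det a b) := by simp [det]; ring
      rw [this] at h1
      by_contra hneg
      push Not at hneg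
      nlinarith
    left
    push Not at h1 h2
    exact ⟨lt_of_le_of_ne h1 (Ne.symm h3), by linarith [lt_of_le_of_ne h2 h4]⟩
  · intro y hy t ht
    constructor
    · rintro rfl
      simp only [Set.mem_inter_iff, Set.mem_union, Set.mem_ofPred_eq, det_add_smul, det_neg,
        det_self, det_swap a b] at hy
      have := mul_nonneg ht hD.le
      rcases hy with h | h | h <;> [skip; skip; skip] <;> obtain ⟨_, h⟩ := h <;> grind
    · rintro rfl
      simp only [Set.mem_inter_iff, Set.mem_union, Set.mem_ofPred_eq, det_add_smul, det_neg,
        det_self] at hy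
      have := mul_nonneg ht hD.le
      rcases hy with h | h | h <;> [skip; skip; skip] <;> obtain ⟨_, h⟩ := h <;> grind

lemma sector (a b x : Pt) (r : ℝ) (hr : 0 < r) (ha : a ≠ 0) (hb : b ≠ 0)
    (hab : ¬ ∃ c : ℝ, 0 < c ∧ b = c • a) :
    ∃ S1 S2 : Set Pt, IsPreconnected S1 ∧ IsPreconnected S2 ∧
      S1 ⊆ Metric.ball x r ∧ S2 ⊆ Metric.ball x r ∧
      (∀ y ∈ Metric.ball x r, y ∈ S1 ∨ y ∈ S2 ∨ (∃ t : ℝ, 0 ≤ t ∧ y = x + t • a) ∨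
        ∃ t : ℝ, 0 ≤ t ∧ y = x + t • b) ∧
      (∀ y, y ∈ S1 ∨ y ∈ S2 → ∀ t : ℝ, 0 ≤ t → y ≠ x + t • a ∧ y ≠ x + t • b) := by
  rcases lt_trichotomy (det a b) 0 with h | h | h
  · obtain ⟨S1, S2, h1, h2, h3, h4, h5, h6⟩ := sector_aux b a x r hr hb ha
      (by rw [det_swap]; linarith)
    refine ⟨S1, S2, h1, h2, h3, h4, fun y hy => ?_, fun y hy t ht => (h6 y hy t ht).symm⟩
    rcases h5 y hy with k | k | k | k
    · exact Or.inl k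
    · exact Or.inr (Or.inl k)
    · exact Or.inr (Or.inr (Or.inr k))
    · exact Or.inr (Or.inr (Or.inl k))
  · obtain ⟨c, hc⟩ := exists_smul_of_det a b ha h
    have hc0 : c < 0 := by
      rcases lt_trichotomy c 0 with h' | h' | h'
      · exact h'
      · exact absurd (by rw [hc, h', zero_smul]) hb
      · exact absurd ⟨c, h', hc⟩ hab
    have hball : Convex ℝ (Metric.ball x r) := convex_ball x r
    refine ⟨Metric.ball x r ∩ {y | 0 < det a (y - x)}, Metric.ball x r ∩ {y | 0 < det (-a) (y - x)},
      (hball.inter (convex_half a x)).isPreconnected,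
      (hball.inter (convex_half (-a) x)).isPreconnected,
      inter_subset_left, inter_subset_left, ?_, ?_⟩
    · intro y hy
      simp only [Set.mem_inter_iff, hy, true_and, Set.mem_ofPred_eq, det_neg]
      rcases lt_trichotomy (det a (y - x)) 0 with h' | h' | h'
      · right; left; linarith
      · right; right
        obtain ⟨d, hd⟩ := exists_smul_of_det a (y - x) ha h'
        rcases le_or_gt 0 d with h0 | h0
        · left; exact ⟨d, h0, by rw [← hd]; abel⟩
        · right
          refine ⟨d / c, (div_pos_of_neg_of_neg h0 hc0).le, ?_⟩
          rw [hc, smul_smul, div_mul_cancel₀ _ hc0.ne, ← hd]; abel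
      · left; exact h'
    · intro y hy t ht
      constructor
      · rintro rfl
        simp only [mem_inter_iff, mem_ofPred_eq, det_add_smul, det_neg, det_self] at hy
        simp at hy
      · rintro rfl
        simp only [mem_inter_iff, mem_ofPred_eq, det_add_smul, det_neg, h] at hy
        simp at hy
  · exact sector_aux a b x r hr ha hb h

variable (Γ : SimplePolygon)

def edge (i : ℤ) : Set Pt := segment ℝ (Γ.vertex i) (Γ.vertex (i + 1))

lemma vertex_congr (i j : ℤ) (h : (Γ.n : ℤ) ∣ (i - j)) : Γ.vertex i = Γ.vertex j := by
  obtain ⟨k, hk⟩ := h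
  have hp : Function.Periodic Γ.vertex (Γ.n : ℤ) := Γ.periodic
  have := hp.int_mul k j
  rw [← this]
  congr 1
  push_cast
  linarith

lemma vertex_eq (i j : ℤ) (h : Γ.vertex i = Γ.vertex j) : (Γ.n : ℤ) ∣ (i - j) := by
  have hn : (0 : ℤ) < Γ.n := by have := Γ.three_le; omega
  have hi := vertex_congr Γ i (i % Γ.n) (Int.dvd_self_sub_emod)
  have hj := vertex_congr Γ j (j % Γ.n) (Int.dvd_self_sub_emod)
  have := Γ.vertex_inj (i % Γ.n) (j % Γ.n) (Int.emod_nonneg _ hn.ne') (Int.emod_lt_of_pos _ hn)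
    (Int.emod_nonneg _ hn.ne') (Int.emod_lt_of_pos _ hn) (by rw [← hi, ← hj, h])
  exact Int.ModEq.dvd (Int.ModEq.symm this)

lemma edge_congr (i j : ℤ) (h : (Γ.n : ℤ) ∣ (i - j)) : edge Γ i = edge Γ j := by
  unfold edge
  rw [vertex_congr Γ i j h, vertex_congr Γ (i + 1) (j + 1) (by simpa using h)]

lemma vertex_succ_ne (i : ℤ) : Γ.vertex i ≠ Γ.vertex (i + 1) := by
  intro h
  have h1 := vertex_eq Γ _ _ h
  have := Γ.three_le
  have h2 : (Γ.n : ℤ) ∣ 1 := by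
    rw [show (1 : ℤ) = -(i - (i + 1)) by ring]; exact (dvd_neg).2 h1
  have := Int.le_of_dvd one_pos h2
  omega

lemma exists_nhd (x : Pt) : ∃ O : Set Pt, IsOpen O ∧ x ∈ O ∧
    ∀ y ∈ O, y ∈ frontier Γ.carrier → ∃ j, y ∈ edge Γ j ∧ x ∈ edge Γ j := by
  have hn : (0 : ℤ) < Γ.n := by have := Γ.three_le; omega
  refine ⟨(⋃ j ∈ {j : ℤ | j ∈ Set.Ico (0 : ℤ) Γ.n ∧ x ∉ edge Γ j}, edge Γ j)ᶜ, ?_, ?_, ?_⟩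
  · rw [isOpen_compl_iff]
    apply Set.Finite.isClosed_biUnion
    · exact (Set.finite_Ico (0 : ℤ) Γ.n).subset (fun j hj => hj.1)
    · intro j _
      unfold edge
      rw [← convexHull_pair]
      exact (Set.toFinite _).isCompact_convexHull (𝕜 := ℝ) |>.isClosed
  · simp
  · intro y hy hyJ
    rw [Γ.boundary_eq] at hyJ
    obtain ⟨i, hi⟩ := mem_iUnion.1 hyJ
    have e := edge_congr Γ i (i % Γ.n) (Int.dvd_self_sub_emod)
    have hi' : y ∈ edge Γ (i % Γ.n) := by rw [← e]; exact hi
    refine ⟨i % Γ.n, hi', ?_⟩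
    by_contra hx
    apply hy
    simp only [mem_iUnion]
    exact ⟨_, ⟨⟨Int.emod_nonneg _ hn.ne', Int.emod_lt_of_pos _ hn⟩, hx⟩, hi'⟩

lemma edge_sub (i : ℤ) : edge Γ i ⊆ frontier Γ.carrier := by
  rw [Γ.boundary_eq]
  exact subset_iUnion (fun i : ℤ => segment ℝ (Γ.vertex i) (Γ.vertex (i + 1))) i

lemma edge_or (i j : ℤ) (x : Pt) (hi : x ∈ edge Γ i) (hj : x ∈ edge Γ j) :
    (Γ.n : ℤ) ∣ (j - i) ∨ ((Γ.n : ℤ) ∣ (j - (i + 1)) ∧ x = Γ.vertex (i + 1)) ∨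
      ((Γ.n : ℤ) ∣ (i - (j + 1)) ∧ x = Γ.vertex i) := by
  by_cases h1 : (Γ.n : ℤ) ∣ (j - i)
  · exact Or.inl h1
  by_cases h2 : (Γ.n : ℤ) ∣ (j - (i + 1))
  · have := Γ.adj_edges i j h2 h1
    have hx : x ∈ ({Γ.vertex j} : Set Pt) := by rw [← this]; exact ⟨hi, hj⟩
    right; left
    refine ⟨h2, ?_⟩
    rw [← vertex_congr Γ _ _ h2]; exact hx
  by_cases h3 : (Γ.n : ℤ) ∣ (i - (j + 1))
  · have := Γ.adj_edges j i h3 (by rwa [dvd_sub_comm])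
    have hx : x ∈ ({Γ.vertex i} : Set Pt) := by rw [← this]; exact ⟨hj, hi⟩
    right; right
    exact ⟨h3, hx⟩
  · exact absurd (Γ.nonadj_edges i j h1 h2 h3) (Set.not_disjoint_iff.2 ⟨x, hi, hj⟩)

def LocalPic (x : Pt) : Prop := ∃ p q : Pt, p ≠ x ∧ q ≠ x ∧
  (¬ ∃ c : ℝ, 0 < c ∧ q - x = c • (p - x)) ∧ ∃ O : Set Pt, IsOpen O ∧ x ∈ O ∧
  ∀ y ∈ O, (y ∈ frontier Γ.carrier ↔ (y ∈ segment ℝ x p ∨ y ∈ segment ℝ x q))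

lemma local_vertex (i : ℤ) : LocalPic Γ (Γ.vertex (i + 1)) := by
  obtain ⟨O, hO, hxO, hO'⟩ := exists_nhd Γ (Γ.vertex (i + 1))
  have hn := Γ.three_le
  have e1 : edge Γ i = segment ℝ (Γ.vertex (i + 1)) (Γ.vertex i) := segment_symm ..
  refine ⟨Γ.vertex i, Γ.vertex (i + 1 + 1), vertex_succ_ne Γ i, (vertex_succ_ne Γ (i + 1)).symm,
    ?_, O, hO, hxO, ?_⟩
  · rintro ⟨c, hc, h⟩
    have hint := Γ.adj_edges i (i + 1) (by simp) (by
      intro hd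
      have : (Γ.n : ℤ) ∣ 1 := by simpa using hd
      have := Int.le_of_dvd one_pos this
      omega)
    set x := Γ.vertex (i + 1)
    have hm : 0 < min 1 c := lt_min one_pos hc
    have hz : x + (min 1 c) • (Γ.vertex i - x) ∈ ({x} : Set Pt) := by
      rw [← hint]
      constructor
      · rw [segment_symm, segment_eq_image']
        exact ⟨min 1 c, ⟨hm.le, min_le_left _ _⟩, rfl⟩
      · rw [segment_eq_image']
        refine ⟨min 1 c / c, ⟨by positivity, (div_le_one hc).2 (min_le_right _ _)⟩, ?_⟩
        simp only
        rw [h, smul_smul, div_mul_cancel₀ _ hc.ne']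
    have : (min 1 c) • (Γ.vertex i - x) = 0 := by simpa using hz
    rcases smul_eq_zero.1 this with h' | h'
    · exact hm.ne' h'
    · exact vertex_succ_ne Γ i (sub_eq_zero.1 h')
  · intro y hy
    rw [← e1]
    constructor
    · intro hJ
      obtain ⟨j, hyj, hxj⟩ := hO' y hy hJ
      have hxi : Γ.vertex (i + 1) ∈ edge Γ i := right_mem_segment ..
      rcases edge_or Γ i j _ hxi hxj with h | ⟨h, _⟩ | ⟨_, h⟩
      · left; rwa [← edge_congr Γ _ _ h]
      · right; rw [edge_congr Γ _ _ h] at hyj; exact hyj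
      · exact absurd h.symm (vertex_succ_ne Γ i)
    · rintro (h | h)
      · exact edge_sub Γ i h
      · exact edge_sub Γ (i + 1) h

lemma local_pic (x : Pt) (hx : x ∈ frontier Γ.carrier) : LocalPic Γ x := by
  have hx' := hx
  rw [Γ.boundary_eq] at hx
  obtain ⟨i, hi⟩ := mem_iUnion.1 hx
  by_cases h1 : x = Γ.vertex (i + 1)
  · rw [h1]; exact local_vertex Γ i
  by_cases h2 : x = Γ.vertex i
  · rw [h2]; simpa using local_vertex Γ (i - 1)
  obtain ⟨O, hO, hxO, hO'⟩ := exists_nhd Γ x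
  refine ⟨Γ.vertex i, Γ.vertex (i + 1), Ne.symm h2, Ne.symm h1, ?_, O, hO, hxO, ?_⟩
  · rintro ⟨c, hc, h⟩
    obtain ⟨s, t, hs, ht, hst, rfl⟩ := hi
    have hs0 : s ≠ 0 := by
      rintro rfl
      apply h1
      have : t = 1 := by linarith
      simp [this]
    have ht0 : t ≠ 0 := by
      rintro rfl
      apply h2
      have : s = 1 := by linarith
      simp [this]
    obtain rfl : s = 1 - t := by linarith
    have hk : ((1 - t) + c * t) • (Γ.vertex (i + 1) - Γ.vertex i) = 0 := by
      rw [← sub_eq_zero] at h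
      rw [← h]
      module
    rcases smul_eq_zero.1 hk with h' | h'
    · have := mul_nonneg hc.le ht
      exact hs0 (by linarith)
    · exact vertex_succ_ne Γ i (sub_eq_zero.1 h').symm
  · intro y hy
    have hsp : y ∈ edge Γ i ↔ (y ∈ segment ℝ x (Γ.vertex i) ∨ y ∈ segment ℝ x (Γ.vertex (i + 1))) := by
      unfold edge
      rw [segment_eq_image'] at hi
      obtain ⟨t, ⟨ht0, ht1⟩, rfl⟩ := hi
      set A := Γ.vertex i
      obtain ⟨u, hu⟩ : ∃ u, Γ.vertex (i + 1) = A + u := ⟨Γ.vertex (i + 1) - A, by simp⟩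
      have k1 := seg_line A u 0 1
      have k2 := seg_line A u t 0
      have k3 := seg_line A u t 1
      simp only [zero_smul, one_smul, add_zero] at k1 k2 k3
      simp only [hu, add_sub_cancel_left]
      rw [k1, k2, k3, ← Set.mem_union, ← Set.image_union]
      have : Set.uIcc (0 : ℝ) 1 = Set.uIcc t 0 ∪ Set.uIcc t 1 := by
        ext r
        simp only [Set.mem_union, Set.mem_uIcc]
        grind
      rw [this]
    rw [← hsp]
    refine ⟨fun hJ => ?_, fun h => edge_sub Γ i h⟩
    obtain ⟨j, hyj, hxj⟩ := hO' y hy hJ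
    rcases edge_or Γ i j _ hi hxj with h | ⟨_, h⟩ | ⟨_, h⟩
    · rwa [← edge_congr Γ _ _ h]
    · exact absurd h h1
    · exact absurd h h2

lemma local_two (x : Pt) (hx : x ∈ frontier Γ.carrier) :
    ∃ N S1 S2 : Set Pt, N ∈ nhds x ∧ IsPreconnected S1 ∧ IsPreconnected S2 ∧
      (∀ y ∈ N, y ∉ frontier Γ.carrier → y ∈ S1 ∨ y ∈ S2) ∧
      S1 ⊆ (frontier Γ.carrier)ᶜ ∧ S2 ⊆ (frontier Γ.carrier)ᶜ := by
  obtain ⟨p, q, hp, hq, hpq, O, hO, hxO, h⟩ := local_pic Γ x hx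
  obtain ⟨r0, hr0, hr0'⟩ := Metric.isOpen_iff.1 hO x hxO
  have ha : p - x ≠ 0 := sub_ne_zero.2 hp
  have hb : q - x ≠ 0 := sub_ne_zero.2 hq
  have ha' := norm_pos_iff.2 ha
  have hb' := norm_pos_iff.2 hb
  set r := min r0 (min ‖p - x‖ ‖q - x‖) with hr
  have hrp : 0 < r := lt_min hr0 (lt_min ha' hb')
  have hray : ∀ z : Pt, 0 < ‖z - x‖ → r ≤ ‖z - x‖ → ∀ t : ℝ, 0 ≤ t → x + t • (z - x) ∈ Metric.ball x r →
      x + t • (z - x) ∈ segment ℝ x z := by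
    intro z hz hrz t ht hb
    rw [mem_ball_iff_norm, add_sub_cancel_left, norm_smul, Real.norm_of_nonneg ht] at hb
    rw [segment_eq_image']
    refine ⟨t, ⟨ht, ?_⟩, rfl⟩
    by_contra hc
    push Not at hc
    nlinarith
  have hsub : Metric.ball x r ⊆ O := (Metric.ball_subset_ball (min_le_left _ _)).trans hr0'
  obtain ⟨S1, S2, h1, h2, h3, h4, h5, h6⟩ := sector (p - x) (q - x) x r hrp ha hb hpq
  have key : ∀ y, y ∈ S1 ∨ y ∈ S2 → y ∉ frontier Γ.carrier := by
    intro y hy hJ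
    have hyO : y ∈ O := hsub (hy.elim (fun k => h3 k) (fun k => h4 k))
    rcases (h y hyO).1 hJ with k | k <;> rw [segment_eq_image'] at k <;>
      obtain ⟨t, ht, rfl⟩ := k
    · exact (h6 _ hy t ht.1).1 rfl
    · exact (h6 _ hy t ht.1).2 rfl
  refine ⟨Metric.ball x r, S1, S2, Metric.ball_mem_nhds x hrp, h1, h2, ?_,
    fun y hy => key y (Or.inl hy), fun y hy => key y (Or.inr hy)⟩
  intro y hy hyJ
  rcases h5 y hy with k | k | ⟨t, ht, rfl⟩ | ⟨t, ht, rfl⟩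
  · exact Or.inl k
  · exact Or.inr k
  · exact absurd ((h _ (hsub hy)).2 (Or.inl (hray p ha'
      ((min_le_right _ _).trans (min_le_left _ _)) t ht hy))) hyJ
  · exact absurd ((h _ (hsub hy)).2 (Or.inr (hray q hb'
      ((min_le_right _ _).trans (min_le_right _ _)) t ht hy))) hyJ

lemma touch (U V : Set Pt) (hU : IsOpen U) (hV : IsOpen V) (hUV : Disjoint U V)
    (hun : U ∪ V = Γ.carrierᶜ) (hne : U.Nonempty) :
    (frontier Γ.carrier ∩ closure U).Nonempty := by
  obtain ⟨z, hz⟩ := Γ.connected.nonempty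
  have hfr : (frontier U).Nonempty := by
    rw [nonempty_iff_ne_empty]
    intro h
    rcases isClopen_iff.1 (isClopen_iff_frontier_eq_empty.2 h) with h' | h'
    · exact hne.ne_empty h'
    · have : z ∈ Γ.carrierᶜ := by rw [← hun, h']; simp
      exact this hz
  obtain ⟨x, hx⟩ := hfr
  rw [hU.frontier_eq] at hx
  have hxΓ : x ∈ Γ.carrier := by
    by_contra hc
    have : x ∈ U ∪ V := by rw [hun]; exact hc
    rcases this with h | h
    · exact hx.2 h
    · exact Set.disjoint_left.1 (hUV.closure_left hV) hx.1 h
  refine ⟨x, ?_, hx.1⟩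
  rw [frontier_eq_closure_inter_closure]
  refine ⟨subset_closure hxΓ, closure_mono ?_ hx.1⟩
  rw [← hun]; exact subset_union_left

lemma no_split (U V : Set Pt) (hU : IsOpen U) (hV : IsOpen V) (hUV : Disjoint U V)
    (hun : U ∪ V = Γ.carrierᶜ) (hneU : U.Nonempty) (hneV : V.Nonempty) : False := by
  have hJ : IsPreconnected (frontier Γ.carrier) := by
    rw [Γ.boundary_eq]
    apply IsPreconnected.iUnion_of_chain
    · intro i; exact (convex_segment _ _).isPreconnected
    · intro i
      exact ⟨Γ.vertex (i + 1), right_mem_segment .., left_mem_segment ..⟩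
  have hcov : frontier Γ.carrier ⊆ closure U ∪ closure V := by
    rw [← closure_union, hun, frontier_eq_closure_inter_closure]
    exact inter_subset_right
  obtain ⟨x, hx, hxU, hxV⟩ := isPreconnected_closed_iff.1 hJ _ _ isClosed_closure isClosed_closure
    hcov (touch Γ U V hU hV hUV hun hneU)
    (touch Γ V U hV hU hUV.symm (by rw [union_comm]; exact hun) hneV)
  have hcl := Γ.compact.isClosed
  have hxI : x ∈ closure (interior Γ.carrier) := by
    rw [← Γ.regular]; exact hcl.frontier_subset hx
  obtain ⟨N, S1, S2, hN, h1, h2, h3, h4, h5⟩ := local_two Γ x hx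
  set I := interior Γ.carrier with hI
  have hIo : IsOpen I := isOpen_interior
  have hUΓ : ∀ y ∈ U, y ∉ Γ.carrier := fun y hy => by
    have : y ∈ Γ.carrierᶜ := by rw [← hun]; exact Or.inl hy
    exact this
  have hVΓ : ∀ y ∈ V, y ∉ Γ.carrier := fun y hy => by
    have : y ∈ Γ.carrierᶜ := by rw [← hun]; exact Or.inr hy
    exact this
  have hdU : Disjoint U I := Set.disjoint_left.2 fun y hy hy' => hUΓ y hy (interior_subset hy')
  have hdV : Disjoint V I := Set.disjoint_left.2 fun y hy hy' => hVΓ y hy (interior_subset hy')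
  have hcompl : (frontier Γ.carrier)ᶜ ⊆ (U ∪ V) ∪ I := by
    intro y hy
    by_cases hyΓ : y ∈ Γ.carrier
    · right
      by_contra hc
      apply hy
      rw [hcl.frontier_eq]; exact ⟨hyΓ, hc⟩
    · left; rw [hun]; exact hyΓ
  have hS : ∀ S : Set Pt, IsPreconnected S → S ⊆ (frontier Γ.carrier)ᶜ → S ⊆ U ∨ S ⊆ V ∨ S ⊆ I := by
    intro S hS hSJ
    rcases IsPreconnected.subset_or_subset (hU.union hV) hIo (hdU.union_left hdV)
      (hSJ.trans hcompl) hS with h | h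
    · rcases IsPreconnected.subset_or_subset hU hV hUV h hS with h | h
      · exact Or.inl h
      · exact Or.inr (Or.inl h)
    · exact Or.inr (Or.inr h)
  obtain ⟨u, huN, hu⟩ := mem_closure_iff_nhds.1 hxU N hN
  obtain ⟨v, hvN, hv⟩ := mem_closure_iff_nhds.1 hxV N hN
  obtain ⟨w, hwN, hw⟩ := mem_closure_iff_nhds.1 hxI N hN
  have hu' := h3 u huN (fun h => hUΓ u hu (hcl.frontier_subset h))
  have hv' := h3 v hvN (fun h => hVΓ v hv (hcl.frontier_subset h))
  have hw' := h3 w hwN (fun h => by rw [hcl.frontier_eq] at h; exact h.2 hw)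
  have d1 := Set.disjoint_left.1 hUV
  have d2 := Set.disjoint_left.1 hdU
  have d3 := Set.disjoint_left.1 hdV
  have s1 := hS S1 h1 h4
  have s2 := hS S2 h2 h5
  simp only [Set.subset_def] at s1 s2
  grind

lemma tri_aux (a b : ℝ) (q : Prop)
    (h : 0 ≤ a → 0 ≤ b → a + b ≤ 1 → (a = 0 ∨ b = 0 ∨ a + b = 1) → q) :
    (¬ q ∧ 0 < a ∧ 0 < b ∧ a + b < 1 ∨ ¬ q ∧ (a < 0 ∨ b < 0 ∨ 1 < a + b)) ↔ ¬ q := by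
  grind

lemma tri_aux2 (a b : ℝ) (h1 : 0 ≤ a) (h2 : 0 ≤ b) (h3 : a + b ≤ 1)
    (h : ¬ (0 < a ∧ 0 < b ∧ a + b < 1)) : a = 0 ∨ b = 0 ∨ a + b = 1 := by
  grind

lemma triangle (A b c : Pt) (hD : det b c ≠ 0)
    (hb : ∀ s : ℝ, 0 ≤ s → s ≤ 1 → A + s • b ∈ Γ.carrier)
    (hc : ∀ s : ℝ, 0 ≤ s → s ≤ 1 → A + s • c ∈ Γ.carrier)
    (hbc : ∀ s t : ℝ, 0 ≤ s → 0 ≤ t → s + t = 1 → A + (s • b + t • c) ∈ Γ.carrier)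
    (s t : ℝ) (hs : 0 ≤ s) (ht : 0 ≤ t) (hst : s + t ≤ 1) :
    A + (s • b + t • c) ∈ Γ.carrier := by
  by_contra hq
  set f : Pt → ℝ := fun y => det (y - A) c / det b c with hf
  set g : Pt → ℝ := fun y => det b (y - A) / det b c with hg
  have fc : Continuous f := (det_cont1 c A).div_const _
  have gc : Continuous g := (det_cont2 b A).div_const _
  have rep : ∀ y, y = A + (f y • b + g y • c) := by
    intro y
    have hD' := hD
    ext i
    fin_cases i
    · simp only [hf, hg, Fin.zero_eta, PiLp.add_apply, PiLp.smul_apply, smul_eq_mul]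
      field_simp
      simp only [det, PiLp.sub_apply]; ring
    · simp only [hf, hg, Fin.mk_one, PiLp.add_apply, PiLp.smul_apply, smul_eq_mul]
      field_simp
      simp only [det, PiLp.sub_apply]; ring
  have fs : ∀ s t : ℝ, f (A + (s • b + t • c)) = s := by
    intro s t
    simp only [hf]; rw [div_eq_iff hD]; simp [det]; ring
  have gs : ∀ s t : ℝ, g (A + (s • b + t • c)) = t := by
    intro s t
    simp only [hg]; rw [div_eq_iff hD]; simp [det]; ring
  have bd : ∀ y, 0 ≤ f y → 0 ≤ g y → f y + g y ≤ 1 → (f y = 0 ∨ g y = 0 ∨ f y + g y = 1) →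
      y ∈ Γ.carrier := by
    intro y h1 h2 h3 h4
    rw [rep y]
    rcases h4 with h | h | h
    · rw [h]; simpa using hc (g y) h2 (by linarith)
    · rw [h]; simpa using hb (f y) h1 (by linarith)
    · exact hbc _ _ h1 h2 h
  have hcl := Γ.compact.isClosed
  refine no_split Γ (Γ.carrierᶜ ∩ {y | 0 < f y ∧ 0 < g y ∧ f y + g y < 1})
    (Γ.carrierᶜ ∩ {y | f y < 0 ∨ g y < 0 ∨ 1 < f y + g y}) ?_ ?_ ?_ ?_ ?_ ?_
  · refine hcl.isOpen_compl.inter ?_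
    exact (isOpen_lt continuous_const fc).inter ((isOpen_lt continuous_const gc).inter
      (isOpen_lt (fc.add gc) continuous_const))
  · refine hcl.isOpen_compl.inter ?_
    exact (isOpen_lt fc continuous_const).union ((isOpen_lt gc continuous_const).union
      (isOpen_lt continuous_const (fc.add gc)))
  · rw [Set.disjoint_left]
    rintro y ⟨_, h1, h2, h3⟩ ⟨_, h | h | h⟩ <;> linarith
  · ext y
    have := bd y
    simp only [mem_union, mem_inter_iff, mem_compl_iff, mem_ofPred_eq]
    exact tri_aux _ _ _ this
  · refine ⟨_, hq, ?_⟩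
    by_contra hcon
    apply hq
    have := bd (A + (s • b + t • c))
    simp only [fs, gs, mem_ofPred_eq] at this hcon
    apply this hs ht hst
    exact tri_aux2 s t hs ht hst hcon
  · obtain ⟨R, hR⟩ := Γ.compact.isBounded.exists_norm_le
    have hb0 : b ≠ 0 := by
      rintro rfl
      apply hD; simp [det]
    have hbp := norm_pos_iff.2 hb0
    set k : ℝ := (|R| + 1 + ‖A‖) / ‖b‖ with hk
    have hkp : 0 < k := by positivity
    refine ⟨A + ((-k) • b + (0 : ℝ) • c), ?_, ?_⟩
    · intro hin
      have h1 := hR _ hin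
      have h2 : ‖(-k) • b‖ = |R| + 1 + ‖A‖ := by
        rw [norm_smul, norm_neg, Real.norm_of_nonneg hkp.le, hk]
        field_simp
      have h3 := norm_sub_le (A + ((-k) • b + (0 : ℝ) • c)) A
      rw [add_sub_cancel_left, zero_smul, add_zero, h2] at h3
      rw [zero_smul, add_zero] at h1
      linarith [le_abs_self R]
    · left; rw [fs]; linarith

lemma main (G1 G2 : Pt) (h : ∀ B ∈ frontier Γ.carrier, Γ.Sees G1 B ∨ Γ.Sees G2 B)
    (P : Pt) (hP : P ∈ Γ.carrier) : Γ.Sees G1 P ∨ Γ.Sees G2 P := by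
  by_contra hcon
  push Not at hcon
  obtain ⟨n1, n2⟩ := hcon
  have hPf : P ∉ frontier Γ.carrier := fun hc => (h P hc).elim n1 n2
  have hne : G1 - P ≠ 0 := by
    intro h0
    apply n1
    rw [sub_eq_zero.1 h0]
    simpa [SimplePolygon.Sees] using hP
  set u := G1 - P with hu
  have hG1 : G1 = P + (1 : ℝ) • u := by simp [hu]
  have col : ∀ G : Pt, ¬ Γ.Sees G P → (∃ s : ℝ, G = P + s • u) → ∀ t : ℝ,
      segment ℝ P (P + t • u) ⊆ Γ.carrier → ¬ Γ.Sees G (P + t • u) := by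
    rintro G hG ⟨s, rfl⟩ t h1 h2
    exact hG (collinear_sees P u s t h2 h1)
  obtain ⟨t1, ht1, hf1, hs1⟩ := ray_hit Γ.carrier Γ.compact P u hP hne
  obtain ⟨t2, ht2, hf2, hs2⟩ := ray_hit Γ.carrier Γ.compact P (-u) hP (neg_ne_zero.2 hne)
  have e2 : P + t2 • (-u) = P + (-t2) • u := by simp
  rw [e2] at hf2 hs2
  have k1 : Γ.Sees G2 (P + t1 • u) := (h _ hf1).resolve_left (col G1 n1 ⟨1, hG1⟩ t1 hs1)
  have k2 : Γ.Sees G2 (P + (-t2) • u) := (h _ hf2).resolve_left (col G1 n1 ⟨1, hG1⟩ (-t2) hs2)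
  have hD0 : det u (G2 - P) ≠ 0 := by
    intro h0
    obtain ⟨s, hs⟩ := exists_smul_of_det u (G2 - P) hne h0
    exact col G2 n2 ⟨s, by rw [← hs]; abel⟩ t1 hs1 k1
  have p1 : 0 < t1 := lt_of_le_of_ne ht1 (by rintro rfl; simp at hf1; exact hPf hf1)
  have p2 : 0 < t2 := lt_of_le_of_ne ht2 (by rintro rfl; simp at hf2; exact hPf hf2)
  have hsum : 0 < t1 + t2 := by linarith
  unfold SimplePolygon.Sees at k1 k2
  have tri := triangle Γ G2 (P + t1 • u - G2) (P + (-t2) • u - G2) (by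
      have : det (P + t1 • u - G2) (P + (-t2) • u - G2) = -(t1 + t2) * det u (G2 - P) := by
        simp [det]; ring
      rw [this]
      exact mul_ne_zero (by linarith) hD0)
    (fun s hs hs' => k1 (by rw [segment_eq_image']; exact ⟨s, ⟨hs, hs'⟩, rfl⟩))
    (fun s hs hs' => k2 (by rw [segment_eq_image']; exact ⟨s, ⟨hs, hs'⟩, rfl⟩))
    (by
      intro s t hs ht hst
      have e : G2 + (s • (P + t1 • u - G2) + t • (P + (-t2) • u - G2))
          = P + (s * t1 - t * t2) • u := by
        obtain rfl : t = 1 - s := by linarith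
        module
      rw [e]
      have e0 : P = P + (0 : ℝ) • u := by simp
      rcases le_total 0 (s * t1 - t * t2) with h0 | h0
      · apply hs1
        have := seg_line P u 0 t1
        rw [← e0] at this
        rw [this, Set.uIcc_of_le ht1]
        exact ⟨_, ⟨h0, by nlinarith⟩, rfl⟩
      · apply hs2
        have := seg_line P u 0 (-t2)
        rw [← e0] at this
        rw [this, Set.uIcc_of_ge (by linarith)]
        exact ⟨_, ⟨by nlinarith, h0⟩, rfl⟩)
  apply n2
  unfold SimplePolygon.Sees
  rw [segment_eq_image']
  rintro _ ⟨r, ⟨hr0, hr1⟩, rfl⟩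
  have hfin := tri (r * (t2 / (t1 + t2))) (r * (t1 / (t1 + t2))) (by positivity) (by positivity)
    (by
      have : r * (t2 / (t1 + t2)) + r * (t1 / (t1 + t2)) = r := by field_simp; ring
      linarith)
  convert hfin using 1
  have ew : t2 / (t1 + t2) = 1 - t1 / (t1 + t2) := by field_simp; ring
  have ez : t1 / (t1 + t2) * (t1 + t2) = t1 := by field_simp
  set w := t1 / (t1 + t2)
  have ev : t1 - w * t1 - w * t2 = 0 := by linarith
  rw [ew]
  have : G2 + ((r * (1 - w)) • (P + t1 • u - G2) + (r * w) • (P + -t2 • u - G2))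
     = G2 + r • (P - G2) + (r * (t1 - w * t1 - w * t2)) • u := by module
  simp only
  rw [this, ev]; simp

end TG

/-- if the boundary is covered by at most two guards, then these guards
cover the entire polygon. -/
theorem two_guards_cover (Γ : SimplePolygon) (F : Set Pt) (hF : F ⊆ Γ.carrier)
    (hFfin : F.Finite) (hcard : F.ncard ≤ 2)
    (hwalls : Γ.Covers F (frontier Γ.carrier)) :
    Γ.Covers F Γ.carrier := by
  intro P hP
  have hmain : ∀ G1 G2 : Pt, F = {G1, G2} → ∃ G ∈ F, Γ.Sees G P := by
    rintro G1 G2 rfl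
    have := TG.main Γ G1 G2 (fun B hB => by simpa using hwalls B hB) P hP
    simpa using this
  have h012 : F.ncard = 0 ∨ F.ncard = 1 ∨ F.ncard = 2 := by omega
  rcases h012 with h | h | h
  · obtain rfl := (Set.ncard_eq_zero hFfin).1 h
    obtain ⟨G, hG, _⟩ := hwalls (Γ.vertex 0) (TG.edge_sub Γ 0 (left_mem_segment ..))
    exact absurd hG (by simp)
  · obtain ⟨a, ha⟩ := Set.ncard_eq_one.1 h
    exact hmain a a (by simp [ha])
  · obtain ⟨a, b, _, hab⟩ := Set.ncard_eq_two.1 h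
    exact hmain a b hab
end
end

section
/- If a simple polygon Γ is not normal, then any configuration of guards covering the boundary of Γ but not all of Γ has at least three members. -/
open Set

noncomputable section

/-- Cross product functional attached to the oriented line `a b`. -/
def crossF (a b y : Pt) : ℝ := (b 0 - a 0) * (y 1 - a 1) - (b 1 - a 1) * (y 0 - a 0)

lemma crossF_cont (a b : Pt) : Continuous (crossF a b) := by
  unfold crossF; fun_prop

lemma crossF_comb (a b x y : Pt) (s t : ℝ) (h : s + t = 1) :
    crossF a b (s • x + t • y) = s * crossF a b x + t * crossF a b y := by
  obtain rfl : s = 1 - t := by linarith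
  simp [crossF]; ring

lemma crossF_seg (a b y : Pt) (hy : y ∈ segment ℝ a b) : crossF a b y = 0 := by
  obtain ⟨s, t, _, _, h, rfl⟩ := hy
  rw [crossF_comb _ _ _ _ _ _ h]
  simp [crossF]; ring_nf; tauto

lemma crossF_dense (a b y : Pt) (hab : a ≠ b) (hy : crossF a b y = 0) (O : Set Pt)
    (hO : IsOpen O) (hyO : y ∈ O) :
    (∃ z ∈ O, 0 < crossF a b z) ∧ (∃ z ∈ O, crossF a b z < 0) := by
  set n : Pt := !₂[-(b 1 - a 1), b 0 - a 0] with hn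
  have hpos : 0 < (b 0 - a 0)^2 + (b 1 - a 1)^2 := by
    by_contra hcon
    apply hab
    have h0 : b 0 - a 0 = 0 := by nlinarith [sq_nonneg (b 0 - a 0), sq_nonneg (b 1 - a 1)]
    have h1 : b 1 - a 1 = 0 := by nlinarith [sq_nonneg (b 0 - a 0), sq_nonneg (b 1 - a 1)]
    ext i; fin_cases i
    · simp; linarith
    · simp; linarith
  have hf : ∀ t : ℝ, crossF a b (y + t • n) = t * ((b 0 - a 0)^2 + (b 1 - a 1)^2) := by
    intro t
    have : crossF a b (y + t • n) = crossF a b y + t * ((b 0 - a 0)^2 + (b 1 - a 1)^2) := by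
      simp [crossF, hn]; ring
    rw [this, hy, zero_add]
  have hc : Continuous (fun t : ℝ => y + t • n) := by fun_prop
  have hop : IsOpen ((fun t : ℝ => y + t • n) ⁻¹' O) := hO.preimage hc
  have h0 : (0:ℝ) ∈ ((fun t : ℝ => y + t • n) ⁻¹' O) := by simpa using hyO
  obtain ⟨e, he, hball⟩ := Metric.isOpen_iff.1 hop 0 h0
  constructor
  · refine ⟨y + (e/2) • n, hball (by simp [abs_of_pos he]; linarith), ?_⟩
    rw [hf]; positivity
  · refine ⟨y + (-(e/2)) • n, hball (by simp [abs_of_pos he]; linarith), ?_⟩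
    rw [hf]; nlinarith [mul_pos he hpos]

lemma clopen_sub (S W F : Set Pt) (hS : IsPreconnected S) (hW : IsOpen W)
    (hf : frontier W ∩ S ⊆ F) (hd : Disjoint S F) (hne : (S ∩ W).Nonempty) : S ⊆ W := by
  apply hS.subset_of_closure_inter_subset hW hne
  rintro y ⟨hy, hyS⟩
  by_contra hyW
  have : y ∈ frontier W := by rw [hW.frontier_eq]; exact ⟨hy, hyW⟩
  exact Set.disjoint_left.1 hd hyS (hf ⟨this, hyS⟩)

def HPos (a b p : Pt) (r : ℝ) : Set Pt := Metric.ball p r ∩ {y | 0 < crossF a b y}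
def HNeg (a b p : Pt) (r : ℝ) : Set Pt := Metric.ball p r ∩ {y | crossF a b y < 0}

lemma HPos_conv (a b p : Pt) (r : ℝ) : Convex ℝ (HPos a b p r) := by
  refine (convex_ball p r).inter ?_
  intro x hx y hy s t hs ht hst
  simp only [Set.mem_ofPred_eq] at *
  rw [crossF_comb _ _ _ _ _ _ hst]
  rcases hs.eq_or_lt with rfl | hs
  · have : t = 1 := by linarith
    subst this; simpa using hy
  · have := mul_pos hs hx
    have := mul_nonneg ht hy.le
    linarith

lemma HNeg_conv (a b p : Pt) (r : ℝ) : Convex ℝ (HNeg a b p r) := by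
  refine (convex_ball p r).inter ?_
  intro x hx y hy s t hs ht hst
  simp only [Set.mem_ofPred_eq] at *
  rw [crossF_comb _ _ _ _ _ _ hst]
  rcases hs.eq_or_lt with rfl | hs
  · have : t = 1 := by linarith
    subst this; simpa using hy
  · have := mul_pos_of_neg_of_neg (neg_lt_zero.2 hs) hx
    have := mul_nonneg ht (neg_nonneg.2 hy.le)
    linarith

lemma halfdisc_sub (a b p : Pt) (r : ℝ) (hr : 0 < r) (hab : a ≠ b) (W : Set Pt) (hW : IsOpen W)
    (hf : frontier W ∩ Metric.ball p r ⊆ segment ℝ a b) (hp : p ∈ closure W) :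
    HPos a b p r ⊆ W ∨ HNeg a b p r ⊆ W := by
  have key1 : (HPos a b p r ∩ W).Nonempty → HPos a b p r ⊆ W := by
    refine clopen_sub _ W (segment ℝ a b) (HPos_conv a b p r).isPreconnected hW ?_ ?_
    · exact fun y hy => hf ⟨hy.1, hy.2.1⟩
    · rw [Set.disjoint_left]; intro y hy hy2
      have := hy.2; simp [crossF_seg a b y hy2] at this
  have key2 : (HNeg a b p r ∩ W).Nonempty → HNeg a b p r ⊆ W := by
    refine clopen_sub _ W (segment ℝ a b) (HNeg_conv a b p r).isPreconnected hW ?_ ?_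
    · exact fun y hy => hf ⟨hy.1, hy.2.1⟩
    · rw [Set.disjoint_left]; intro y hy hy2
      have := hy.2; simp [crossF_seg a b y hy2] at this
  obtain ⟨w, hwb, hwW⟩ := mem_closure_iff.1 hp _ Metric.isOpen_ball (Metric.mem_ball_self hr)
  rcases lt_trichotomy (crossF a b w) 0 with h | h | h
  · exact Or.inr (key2 ⟨w, ⟨hwb, h⟩, hwW⟩)
  · obtain ⟨⟨z, hz, hz'⟩, _⟩ := crossF_dense a b w hab h _ (Metric.isOpen_ball.inter hW) ⟨hwb, hwW⟩
    exact Or.inl (key1 ⟨z, ⟨hz.1, hz'⟩, hz.2⟩)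
  · exact Or.inl (key1 ⟨w, ⟨hwb, h⟩, hwW⟩)

lemma seg_local (a b p : Pt) (r : ℝ) (hr : 0 < r) (hab : a ≠ b) (W : Set Pt) (hW : IsOpen W)
    (hf : frontier W ∩ Metric.ball p r ⊆ segment ℝ a b) (hp : p ∈ closure W) :
    Metric.ball p r ∩ segment ℝ a b ⊆ closure W := by
  rintro y ⟨hyb, hys⟩
  have h0 := crossF_seg a b y hys
  rw [mem_closure_iff]
  intro O hO hyO
  obtain ⟨⟨z, hz, hz'⟩, ⟨z2, hz2, hz2'⟩⟩ :=
    crossF_dense a b y hab h0 _ (Metric.isOpen_ball.inter hO) ⟨hyb, hyO⟩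
  rcases halfdisc_sub a b p r hr hab W hW hf hp with h | h
  · exact ⟨z, hz.2, h ⟨hz.1, hz'⟩⟩
  · exact ⟨z2, hz2.2, h ⟨hz2.1, hz2'⟩⟩

/-- Vertex lemma. -/
lemma vertex_local (v a b : Pt) (r : ℝ) (hr : 0 < r) (hva : v ≠ a) (hvb : v ≠ b)
    (hra : r ≤ dist a v)
    (hab : segment ℝ v a ∩ segment ℝ v b ⊆ {v}) (W : Set Pt) (hW : IsOpen W)
    (hf : frontier W ∩ Metric.ball v r ⊆ segment ℝ v a ∪ segment ℝ v b) (hv : v ∈ closure W) :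
    ∃ p ∈ openSegment ℝ v a, p ∈ closure W := by
  by_contra hcon
  push Not at hcon
  set D : Set Pt := Metric.ball v r \ {y | ∃ t : ℝ, 0 ≤ t ∧ y = v + t • (b - v)} with hD
  have hbv : b - v ≠ 0 := sub_ne_zero.2 hvb.symm
  have hnb : 0 < ‖b - v‖ := norm_pos_iff.2 hbv
  have hray : segment ℝ v b ⊆ {y | ∃ t : ℝ, 0 ≤ t ∧ y = v + t • (b - v)} := by
    rw [segment_eq_image']
    rintro y ⟨t, ht, rfl⟩
    exact ⟨t, ht.1, rfl⟩
  set e : ℝ := r / (2 * ‖b - v‖) with he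
  have hepos : 0 < e := by positivity
  have hcball : v + (-e) • (b - v) ∈ Metric.ball v r := by
    rw [Metric.mem_ball, dist_eq_norm, add_sub_cancel_left, norm_smul, norm_neg,
      Real.norm_of_nonneg hepos.le, he]
    field_simp; linarith
  have hstar : StarConvex ℝ (v + (-e) • (b - v)) D := by
    intro y hy s t hs ht hst
    refine ⟨convex_ball v r hcball hy.1 hs ht hst, ?_⟩
    rintro ⟨τ, hτ, heq⟩
    rcases ht.eq_or_lt with rfl | ht
    · have hs1 : s = 1 := by linarith
      subst hs1
      have : (τ + e) • (b - v) = 0 := by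
        have h2 : (τ + e) • (b - v) = (v + τ • (b - v)) - (v + (-e) • (b - v)) := by module
        rw [h2, ← heq]; simp
      rcases smul_eq_zero.1 this with h | h
      · linarith
      · exact hbv h
    · apply hy.2
      refine ⟨(τ + s * e) / t, by positivity, ?_⟩
      have h3 : t • y = t • v + (τ + s * e) • (b - v) := by
        have : t • y = (v + τ • (b - v)) - s • (v + (-e) • (b - v)) := by rw [← heq]; abel
        rw [this]
        obtain rfl : s = 1 - t := by linarith
        module
      have : y = t⁻¹ • (t • y) := by rw [smul_smul, inv_mul_cancel₀ ht.ne', one_smul]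
      rw [this, h3, smul_add, smul_smul, smul_smul, inv_mul_cancel₀ ht.ne', one_smul]
      congr 2; field_simp
  have hcD : v + (-e) • (b - v) ∈ D := by
    refine ⟨hcball, ?_⟩
    rintro ⟨τ, hτ, heq⟩
    have : (τ + e) • (b - v) = 0 := by
      have h2 : (τ + e) • (b - v) = (v + τ • (b - v)) - (v + (-e) • (b - v)) := by module
      rw [h2, ← heq]; simp
    rcases smul_eq_zero.1 this with h | h
    · linarith
    · exact hbv h
  have hpre : IsPreconnected D := (hstar.isPathConnected hcD).isConnected.isPreconnected
  have hDW : (D ∩ W).Nonempty := by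
    obtain ⟨w, hwb, hwW⟩ := mem_closure_iff.1 hv _ Metric.isOpen_ball (Metric.mem_ball_self hr)
    by_cases hw : crossF v b w = 0
    · obtain ⟨⟨z, hz, hz'⟩, _⟩ := crossF_dense v b w hvb hw _
        (Metric.isOpen_ball.inter hW) ⟨hwb, hwW⟩
      refine ⟨z, ⟨hz.1, ?_⟩, hz.2⟩
      rintro ⟨t, ht, rfl⟩
      have : crossF v b (v + t • (b - v)) = 0 := by simp [crossF]; ring
      linarith
    · refine ⟨w, ⟨hwb, ?_⟩, hwW⟩
      rintro ⟨t, ht, rfl⟩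
      apply hw
      simp [crossF]; ring
  have hsub : D ⊆ W := by
    apply hpre.subset_of_closure_inter_subset hW hDW
    rintro y ⟨hy, hyS⟩
    by_contra hyW
    have hyf : y ∈ frontier W := by rw [hW.frontier_eq]; exact ⟨hy, hyW⟩
    rcases hf ⟨hyf, hyS.1⟩ with h | h
    · have h1 : v ≠ y := by
        rintro rfl; exact hyS.2 ⟨0, le_rfl, by simp⟩
      have h2 : a ≠ y := by
        rintro rfl
        exact absurd (Metric.mem_ball.1 hyS.1) (not_lt.2 hra)
      exact hcon y (mem_openSegment_of_ne_left_right h1 h2 h) hy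
    · exact hyS.2 (hray h)
  -- a point of the edge `v a` very close to `v`
  have hav : a - v ≠ 0 := sub_ne_zero.2 hva.symm
  have hna : 0 < ‖a - v‖ := norm_pos_iff.2 hav
  set m : ℝ := min (1/2) (r / (2 * ‖a - v‖)) with hm
  have hmpos : 0 < m := by positivity
  have hmr : m * ‖a - v‖ < r := by
    have : m ≤ r / (2 * ‖a - v‖) := min_le_right _ _
    calc m * ‖a - v‖ ≤ r / (2 * ‖a - v‖) * ‖a - v‖ := by gcongr
      _ = r / 2 := by field_simp
      _ < r := by linarith
  have hm1 : m < 1 := lt_of_le_of_lt (min_le_left _ _) (by norm_num)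
  -- the point is not on the ray through `b`, after shrinking
  by_cases hex : ∃ t : ℝ, 0 ≤ t ∧ v + m • (a - v) = v + t • (b - v)
  · obtain ⟨t, ht, heq⟩ := hex
    have heq' : m • (a - v) = t • (b - v) := add_left_cancel heq
    -- scale
    set k : ℝ := 1 / (1 + t) with hk
    have hkpos : 0 < k := by positivity
    have hk1 : k ≤ 1 := by rw [hk, div_le_one (by positivity)]; linarith
    have hkt : k * t ≤ 1 := by rw [hk, div_mul_eq_mul_div, div_le_one (by positivity)]; linarith
    have hmem1 : v + (k * m) • (a - v) ∈ segment ℝ v a := by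
      rw [segment_eq_image']
      exact ⟨k * m, ⟨by positivity, by nlinarith⟩, rfl⟩
    have hmem2 : v + (k * m) • (a - v) ∈ segment ℝ v b := by
      rw [segment_eq_image']
      refine ⟨k * t, ⟨by positivity, hkt⟩, ?_⟩
      simp only [mul_smul, heq']
    have := hab ⟨hmem1, hmem2⟩
    rw [Set.mem_singleton_iff, add_eq_left, smul_eq_zero] at this
    rcases this with h | h
    · have : 0 < k * m := by positivity
      linarith
    · exact hav h
  · have hin : v + m • (a - v) ∈ D := by
      refine ⟨?_, hex⟩
      rw [Metric.mem_ball, dist_eq_norm, add_sub_cancel_left, norm_smul,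
        Real.norm_of_nonneg hmpos.le]
      exact hmr
    refine hcon (v + m • (a - v)) ?_ (subset_closure (hsub hin))
    rw [openSegment_eq_image']
    exact ⟨m, ⟨hmpos, hm1⟩, rfl⟩

lemma segment_subset_union_aux {x y z w : Pt} (hz : z ∈ segment ℝ x y) (hw : w ∈ segment ℝ x y) :
    w ∈ segment ℝ z x ∪ segment ℝ z y := by
  rw [← insert_endpoints_openSegment] at hw
  rcases hw with rfl | rfl | hw
  · exact Or.inl (right_mem_segment _ _ _)
  · exact Or.inr (right_mem_segment _ _ _)
  · have hz' : z ∈ Set.range (AffineMap.lineMap x y : ℝ → Pt) := by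
      rw [segment_eq_image_lineMap] at hz
      exact Set.image_subset_range _ _ hz
    rcases openSegment_subset_union x y hz' hw with rfl | h | h
    · exact Or.inl (left_mem_segment _ _ _)
    · left; rw [segment_symm]; exact openSegment_subset_segment _ _ _ h
    · right; exact openSegment_subset_segment _ _ _ h

namespace SimplePolygon
variable (Γ : SimplePolygon)

def edge (i : ℤ) : Set Pt := segment ℝ (Γ.vertex i) (Γ.vertex (i + 1))

lemma vertex_add_mul (i k : ℤ) : Γ.vertex (i + k * Γ.n) = Γ.vertex i := by
  have hp : Function.Periodic Γ.vertex (Γ.n : ℤ) := Γ.periodic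
  have := hp.int_mul k i
  simpa using this

lemma vertex_congr (i j : ℤ) (h : (Γ.n : ℤ) ∣ j - i) : Γ.vertex j = Γ.vertex i := by
  obtain ⟨k, hk⟩ := h
  have : j = i + k * Γ.n := by linarith [mul_comm k (Γ.n : ℤ)]
  rw [this, vertex_add_mul]

lemma edge_congr (i j : ℤ) (h : (Γ.n : ℤ) ∣ j - i) : Γ.edge j = Γ.edge i := by
  unfold edge
  rw [Γ.vertex_congr i j h, Γ.vertex_congr (i+1) (j+1) (by simpa using h)]

lemma n_pos : (0 : ℤ) < Γ.n := by have := Γ.three_le; omega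

lemma vertex_ne (i : ℤ) : Γ.vertex i ≠ Γ.vertex (i + 1) := by
  intro h
  have hn := Γ.n_pos
  have h3 := Γ.three_le
  have e1 := Γ.vertex_congr i (i % Γ.n) (by
    rw [← dvd_neg, neg_sub]; exact Int.dvd_self_sub_emod)
  have e2 := Γ.vertex_congr (i+1) ((i+1) % Γ.n) (by
    rw [← dvd_neg, neg_sub]; exact Int.dvd_self_sub_emod)
  have := Γ.vertex_inj _ _ (Int.emod_nonneg i hn.ne') (Int.emod_lt_of_pos i hn)
    (Int.emod_nonneg (i+1) hn.ne') (Int.emod_lt_of_pos (i+1) hn) (by rw [e1, e2, h])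
  have hd : (Γ.n : ℤ) ∣ 1 := by
    have := Int.emod_emod_of_dvd
    have h4 : (Γ.n : ℤ) ∣ (i + 1) - i := Int.ModEq.dvd ‹i % (Γ.n : ℤ) = (i+1) % Γ.n›
    simpa using h4
  have := Int.le_of_dvd one_pos hd
  omega

lemma edge_closed (i : ℤ) : IsClosed (Γ.edge i) := by
  unfold edge
  rw [← convexHull_pair]
  exact (Set.toFinite _).isClosed_convexHull ℝ

lemma edge_far (p : Pt) : ∃ r > 0, ∀ j, p ∉ Γ.edge j → ∀ y ∈ Metric.ball p r, y ∉ Γ.edge j := by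
  have hfin : ({j : ℤ | 0 ≤ j ∧ j < Γ.n ∧ p ∉ Γ.edge j}).Finite :=
    (Set.finite_Ico (0:ℤ) Γ.n).subset (fun j hj => ⟨hj.1, hj.2.1⟩)
  have hcl : IsClosed (⋃ j ∈ {j : ℤ | 0 ≤ j ∧ j < Γ.n ∧ p ∉ Γ.edge j}, Γ.edge j) :=
    hfin.isClosed_biUnion (fun j _ => Γ.edge_closed j)
  have hp : p ∈ (⋃ j ∈ {j : ℤ | 0 ≤ j ∧ j < Γ.n ∧ p ∉ Γ.edge j}, Γ.edge j)ᶜ := by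
    simp only [Set.mem_compl_iff, Set.mem_iUnion, not_exists]
    intro j hj; exact hj.2.2
  obtain ⟨r, hr, hb⟩ := Metric.isOpen_iff.1 hcl.isOpen_compl p hp
  refine ⟨r, hr, fun j hj y hy hyj => ?_⟩
  have hn := Γ.n_pos
  have e : Γ.edge (j % Γ.n) = Γ.edge j := Γ.edge_congr j _ (by
    rw [← dvd_neg, neg_sub]; exact Int.dvd_self_sub_emod)
  apply hb hy
  refine Set.mem_biUnion (x := j % Γ.n) ?_ (by rw [e]; exact hyj)
  exact ⟨Int.emod_nonneg j hn.ne', Int.emod_lt_of_pos j hn, by rw [e]; exact hj⟩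

lemma mem_edge_open (i j : ℤ) (p : Pt) (hp : p ∈ openSegment ℝ (Γ.vertex i) (Γ.vertex (i+1)))
    (hj : p ∈ Γ.edge j) : Γ.edge j = Γ.edge i := by
  have hpi : p ∈ Γ.edge i := openSegment_subset_segment _ _ _ hp
  have hne : Γ.vertex i ≠ Γ.vertex (i+1) := Γ.vertex_ne i
  have hl : Γ.vertex i ≠ p := by
    rintro h; rw [← h, left_mem_openSegment_iff] at hp; exact hne hp
  have hr : Γ.vertex (i+1) ≠ p := by
    rintro h; rw [← h, right_mem_openSegment_iff] at hp; exact hne hp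
  by_cases h1 : (Γ.n : ℤ) ∣ j - i
  · exact Γ.edge_congr i j h1
  exfalso
  by_cases h2 : (Γ.n : ℤ) ∣ j - (i + 1)
  · have := (Γ.adj_edges i j h2 h1).subset ⟨hpi, hj⟩
    rw [Set.mem_singleton_iff] at this
    exact hr (by rw [this, Γ.vertex_congr (i+1) j h2])
  by_cases h3 : (Γ.n : ℤ) ∣ i - (j + 1)
  · have := (Γ.adj_edges j i h3 (by rwa [← dvd_neg, neg_sub])).subset ⟨hj, hpi⟩
    exact hl this.symm
  · exact Set.disjoint_left.1 (Γ.nonadj_edges i j h1 h2 h3) hpi hj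

lemma mem_edge_vertex (i j : ℤ) (hj : Γ.vertex i ∈ Γ.edge j) :
    Γ.edge j = Γ.edge i ∨ Γ.edge j = Γ.edge (i - 1) := by
  have hi : Γ.vertex i ∈ Γ.edge i := left_mem_segment _ _ _
  by_cases h1 : (Γ.n : ℤ) ∣ j - i
  · exact Or.inl (Γ.edge_congr i j h1)
  by_cases h2 : (Γ.n : ℤ) ∣ j - (i + 1)
  · exfalso
    have := (Γ.adj_edges i j h2 h1).subset ⟨hi, hj⟩
    rw [Set.mem_singleton_iff, Γ.vertex_congr (i+1) j h2] at this
    exact Γ.vertex_ne i this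
  by_cases h3 : (Γ.n : ℤ) ∣ i - (j + 1)
  · refine Or.inr (Γ.edge_congr _ _ ?_)
    have e : j - (i - 1) = -(i - (j + 1)) := by ring
    rw [e, dvd_neg]; exact h3
  · exact absurd hj (Set.disjoint_left.1 (Γ.nonadj_edges i j h1 h2 h3) hi)

lemma open_nbhd (i : ℤ) (p : Pt) (hp : p ∈ openSegment ℝ (Γ.vertex i) (Γ.vertex (i+1))) :
    ∃ r > 0, frontier Γ.carrier ∩ Metric.ball p r ⊆ segment ℝ (Γ.vertex i) (Γ.vertex (i+1)) := by
  obtain ⟨r, hr, h⟩ := Γ.edge_far p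
  refine ⟨r, hr, ?_⟩
  rintro y ⟨hy, hyb⟩
  rw [Γ.boundary_eq] at hy
  obtain ⟨j, hj⟩ := Set.mem_iUnion.1 hy
  have hpj : p ∈ Γ.edge j := by
    by_contra hc; exact h j hc y hyb hj
  have := Γ.mem_edge_open i j p hp hpj
  exact this.subset hj

lemma vertex_nbhd (i : ℤ) :
    ∃ r > 0, frontier Γ.carrier ∩ Metric.ball (Γ.vertex i) r ⊆
      segment ℝ (Γ.vertex i) (Γ.vertex (i+1)) ∪ segment ℝ (Γ.vertex i) (Γ.vertex (i-1)) := by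
  obtain ⟨r, hr, h⟩ := Γ.edge_far (Γ.vertex i)
  refine ⟨r, hr, ?_⟩
  rintro y ⟨hy, hyb⟩
  rw [Γ.boundary_eq] at hy
  obtain ⟨j, hj⟩ := Set.mem_iUnion.1 hy
  have hpj : Γ.vertex i ∈ Γ.edge j := by
    by_contra hc; exact h j hc y hyb hj
  rcases Γ.mem_edge_vertex i j hpj with h | h
  · exact Or.inl (h.subset hj)
  · right
    have := h.subset hj
    rw [edge, sub_add_cancel] at this
    rwa [segment_symm]

lemma edge_spread (W : Set Pt) (hW : IsOpen W) (hf : frontier W ⊆ frontier Γ.carrier) (i : ℤ)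
    (p : Pt) (hp : p ∈ openSegment ℝ (Γ.vertex i) (Γ.vertex (i+1))) (hpW : p ∈ closure W) :
    Γ.edge i ⊆ closure W := by
  have hop : openSegment ℝ (Γ.vertex i) (Γ.vertex (i+1)) ⊆ closure W := by
    by_contra hcon
    obtain ⟨q, hq, hqW⟩ := Set.not_subset.1 hcon
    have hpre : IsPreconnected (openSegment ℝ (Γ.vertex i) (Γ.vertex (i+1))) :=
      (convex_openSegment _ _).isPreconnected
    have hopen : IsOpen {y : Pt | ∃ r > 0, Metric.ball y r ∩ Γ.edge i ⊆ closure W} := by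
      rw [Metric.isOpen_iff]
      rintro y ⟨r, hr, h⟩
      refine ⟨r/2, by positivity, fun z hz => ⟨r/2, by positivity, ?_⟩⟩
      refine subset_trans (Set.inter_subset_inter_left _ ?_) h
      apply Metric.ball_subset_ball'
      rw [Metric.mem_ball] at hz; linarith
    have hloc : ∀ y ∈ openSegment ℝ (Γ.vertex i) (Γ.vertex (i+1)), y ∈ closure W →
        y ∈ {y : Pt | ∃ r > 0, Metric.ball y r ∩ Γ.edge i ⊆ closure W} := by
      intro y hy hyW
      obtain ⟨r, hr, h⟩ := Γ.open_nbhd i y hy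
      exact ⟨r, hr, seg_local _ _ y r hr (Γ.vertex_ne i) W hW
        (subset_trans (Set.inter_subset_inter_left _ hf) h) hyW⟩
    obtain ⟨y, hy, ⟨r, hr, h⟩, hy2⟩ := hpre _ (closure W)ᶜ hopen isClosed_closure.isOpen_compl
      (fun y hy => by
        by_cases h : y ∈ closure W
        · exact Or.inl (hloc y hy h)
        · exact Or.inr h) ⟨p, hp, hloc p hp hpW⟩ ⟨q, hq, hqW⟩
    exact hy2 (h ⟨Metric.mem_ball_self hr, openSegment_subset_segment _ _ _ hy⟩)
  have := closure_mono hop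
  rw [closure_closure, closure_openSegment] at this
  exact this

lemma prev_inter (i : ℤ) : segment ℝ (Γ.vertex i) (Γ.vertex (i+1)) ∩
    segment ℝ (Γ.vertex i) (Γ.vertex (i-1)) ⊆ {Γ.vertex i} := by
  have h3 := Γ.three_le
  have := Γ.adj_edges (i-1) i (by simp) (by
    intro h
    have h' : (Γ.n : ℤ) ∣ 1 := by simpa using h
    have := Int.le_of_dvd one_pos h'
    omega)
  rw [sub_add_cancel] at this
  rw [Set.inter_comm, segment_symm ℝ (Γ.vertex i) (Γ.vertex (i-1)), this]

lemma vertex_spread (W : Set Pt) (hW : IsOpen W) (hf : frontier W ⊆ frontier Γ.carrier) (i : ℤ)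
    (hi : Γ.vertex i ∈ closure W) : Γ.edge i ⊆ closure W := by
  obtain ⟨r, hr, h⟩ := Γ.vertex_nbhd i
  have hne := Γ.vertex_ne i
  have hne2 : Γ.vertex i ≠ Γ.vertex (i-1) := by
    have := Γ.vertex_ne (i-1); rw [sub_add_cancel] at this; exact this.symm
  have hd : 0 < dist (Γ.vertex (i+1)) (Γ.vertex i) := dist_pos.2 hne.symm
  obtain ⟨p, hp, hpW⟩ := vertex_local (Γ.vertex i) (Γ.vertex (i+1)) (Γ.vertex (i-1))
    (min r (dist (Γ.vertex (i+1)) (Γ.vertex i))) (lt_min hr hd) hne hne2 (min_le_right _ _)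
    (Γ.prev_inter i) W hW
    (subset_trans (Set.inter_subset_inter hf (Metric.ball_subset_ball (min_le_left _ _))) h) hi
  exact Γ.edge_spread W hW hf i p hp hpW

lemma all_spread (W : Set Pt) (hW : IsOpen W) (hf : frontier W ⊆ frontier Γ.carrier)
    (hne : W.Nonempty) (hun : W ≠ Set.univ) : frontier Γ.carrier ⊆ closure W := by
  obtain ⟨p, hp⟩ := nonempty_frontier_iff.2 ⟨hne, hun⟩
  have hpJ := hf hp
  have hpW : p ∈ closure W := frontier_subset_closure hp
  rw [Γ.boundary_eq] at hpJ
  obtain ⟨i, hpi⟩ := Set.mem_iUnion.1 hpJ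
  have hnext : ∀ i, Γ.vertex i ∈ closure W → Γ.vertex (i+1) ∈ closure W := fun i hi =>
    Γ.vertex_spread W hW hf i hi (right_mem_segment _ _ _)
  have hstart : Γ.vertex (i+1) ∈ closure W := by
    by_cases h1 : Γ.vertex i = p
    · exact hnext i (h1 ▸ hpW)
    by_cases h2 : Γ.vertex (i+1) = p
    · exact h2 ▸ hpW
    exact Γ.edge_spread W hW hf i p (mem_openSegment_of_ne_left_right h1 h2 hpi) hpW
      (right_mem_segment _ _ _)
  have hk : ∀ k : ℕ, Γ.vertex (i + 1 + k) ∈ closure W := by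
    intro k
    induction k with
    | zero => simpa using hstart
    | succ k ih =>
      have := hnext _ ih
      push_cast
      rwa [← add_assoc]
  have hall : ∀ j, Γ.vertex j ∈ closure W := by
    intro j
    have hn := Γ.n_pos
    have h0 := Int.emod_nonneg (j - (i+1)) hn.ne'
    have := hk ((j - (i+1)) % Γ.n).toNat
    rw [Int.toNat_of_nonneg h0] at this
    rwa [Γ.vertex_congr j _ ?_] at this
    have h := Int.dvd_self_sub_emod (m := (Γ.n : ℤ)) (x := j - (i+1))
    have e : i + 1 + (j - (i+1)) % Γ.n - j = -(j - (i+1) - (j - (i+1)) % Γ.n) := by ring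
    rw [e, dvd_neg]; exact h
  rw [Γ.boundary_eq]
  exact Set.iUnion_subset fun j => Γ.vertex_spread W hW hf j (hall j)

lemma ball_HPos_nonempty (a b p : Pt) (r : ℝ) (hr : 0 < r) (hab : a ≠ b) (hp : p ∈ segment ℝ a b) :
    (HPos a b p r).Nonempty ∧ (HNeg a b p r).Nonempty := by
  obtain ⟨⟨z, hz, hz'⟩, ⟨z2, hz2, hz2'⟩⟩ := crossF_dense a b p hab (crossF_seg a b p hp) _
    Metric.isOpen_ball (Metric.mem_ball_self hr)
  exact ⟨⟨z, hz, hz'⟩, ⟨z2, hz2, hz2'⟩⟩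

lemma no_three (W₁ W₂ W₃ : Set Pt) (h1 : IsOpen W₁) (h2 : IsOpen W₂) (h3 : IsOpen W₃)
    (f1 : frontier W₁ ⊆ frontier Γ.carrier) (f2 : frontier W₂ ⊆ frontier Γ.carrier)
    (f3 : frontier W₃ ⊆ frontier Γ.carrier) (n1 : W₁.Nonempty) (n2 : W₂.Nonempty)
    (n3 : W₃.Nonempty) (d12 : Disjoint W₁ W₂) (d13 : Disjoint W₁ W₃) (d23 : Disjoint W₂ W₃) :
    False := by
  have hne := Γ.vertex_ne 0
  obtain ⟨p, hp⟩ : (openSegment ℝ (Γ.vertex 0) (Γ.vertex (0+1))).Nonempty :=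
    ⟨_, midpoint_mem_openSegment _ _⟩
  have hps := openSegment_subset_segment _ _ _ hp
  have hpJ : p ∈ frontier Γ.carrier := by
    rw [Γ.boundary_eq]; exact Set.mem_iUnion.2 ⟨0, hps⟩
  have u : ∀ A B : Set Pt, Disjoint A B → B.Nonempty → A ≠ Set.univ := by
    rintro A B h ⟨x, hx⟩ rfl
    exact Set.disjoint_left.1 h (Set.mem_univ x) hx
  have c1 := Γ.all_spread W₁ h1 f1 n1 (u _ _ d12 n2) hpJ
  have c2 := Γ.all_spread W₂ h2 f2 n2 (u _ _ d12.symm n1) hpJ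
  have c3 := Γ.all_spread W₃ h3 f3 n3 (u _ _ d13.symm n1) hpJ
  obtain ⟨r, hr, h⟩ := Γ.open_nbhd 0 p hp
  obtain ⟨⟨z, hz⟩, ⟨y, hy⟩⟩ := ball_HPos_nonempty _ _ p r hr hne hps
  have k1 := halfdisc_sub _ _ p r hr hne W₁ h1 (subset_trans (Set.inter_subset_inter_left _ f1) h) c1
  have k2 := halfdisc_sub _ _ p r hr hne W₂ h2 (subset_trans (Set.inter_subset_inter_left _ f2) h) c2
  have k3 := halfdisc_sub _ _ p r hr hne W₃ h3 (subset_trans (Set.inter_subset_inter_left _ f3) h) c3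
  rw [Set.disjoint_left] at d12 d13 d23
  rcases k1 with k1 | k1 <;> rcases k2 with k2 | k2 <;> rcases k3 with k3 | k3
  all_goals first
    | exact d12 (k1 hz) (k2 hz)
    | exact d12 (k1 hy) (k2 hy)
    | exact d13 (k1 hz) (k3 hz)
    | exact d13 (k1 hy) (k3 hy)
    | exact d23 (k2 hz) (k3 hz)
    | exact d23 (k2 hy) (k3 hy)

lemma closed : IsClosed Γ.carrier := Γ.compact.isClosed

/-- No holes: a compact set whose frontier lies in `Γ` lies in `Γ`. -/
lemma no_holes (T : Set Pt) (hT : IsCompact T) (hfT : frontier T ⊆ Γ.carrier) :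
    T ⊆ Γ.carrier := by
  by_contra hcon
  obtain ⟨z, hzT, hz⟩ := Set.not_subset.1 hcon
  have hU : interior T ∩ Γ.carrierᶜ = T ∩ Γ.carrierᶜ := by
    ext y
    refine ⟨fun h => ⟨interior_subset h.1, h.2⟩, fun h => ⟨?_, h.2⟩⟩
    by_contra hy
    exact h.2 (hfT ⟨subset_closure h.1, hy⟩)
  have hoc := Γ.closed.isOpen_compl
  have hUo : IsOpen (T ∩ Γ.carrierᶜ) := hU ▸ isOpen_interior.inter hoc
  have hVo : IsOpen (Tᶜ ∩ Γ.carrierᶜ) := hT.isClosed.isOpen_compl.inter hoc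
  have hdUV : Disjoint (T ∩ Γ.carrierᶜ) (Tᶜ ∩ Γ.carrierᶜ) :=
    Set.disjoint_left.2 fun y h1 h2 => h2.1 h1.1
  have gen : ∀ A B : Set Pt, IsOpen A → IsOpen B → Disjoint A B → A ∪ B = Γ.carrierᶜ →
      frontier A ⊆ frontier Γ.carrier := by
    intro A B hA hB hd he y hy
    rw [hA.frontier_eq] at hy
    have hyB : y ∉ B := fun h => Set.disjoint_left.1 (hd.closure_left hB) hy.1 h
    have hyG : y ∈ Γ.carrier := by
      by_contra hc
      have : y ∈ A ∪ B := he ▸ hc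
      exact this.elim hy.2 hyB
    rw [frontier_eq_closure_inter_closure]
    exact ⟨subset_closure hyG, closure_mono (he ▸ Set.subset_union_left) hy.1⟩
  have hun : (T ∩ Γ.carrierᶜ) ∪ (Tᶜ ∩ Γ.carrierᶜ) = Γ.carrierᶜ := by
    ext y; by_cases h : y ∈ T <;> simp [h]
  refine Γ.no_three (T ∩ Γ.carrierᶜ) (Tᶜ ∩ Γ.carrierᶜ) (interior Γ.carrier) hUo hVo
    isOpen_interior (gen _ _ hUo hVo hdUV hun) (gen _ _ hVo hUo hdUV.symm
      (by rw [Set.union_comm]; exact hun)) frontier_interior_subset ⟨z, hzT, hz⟩ ?_ ?_ hdUV ?_ ?_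
  · have hc : IsCompact (T ∪ Γ.carrier) := hT.union Γ.compact
    have hne : T ∪ Γ.carrier ≠ Set.univ := hc.ne_univ
    obtain ⟨y, hy⟩ := (Set.ne_univ_iff_exists_notMem _).1 hne
    exact ⟨y, fun h => hy (Or.inl h), fun h => hy (Or.inr h)⟩
  · have h := Γ.connected.nonempty
    rw [Γ.regular] at h
    exact closure_nonempty_iff.1 h
  · exact Set.disjoint_left.2 fun y h1 h2 => h1.2 (interior_subset h2)
  · exact Set.disjoint_left.2 fun y h1 h2 => h1.2 (interior_subset h2)

lemma triangle_frontier (P B C : Pt) (h : AffineIndependent ℝ ![P, B, C]) :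
    frontier (convexHull ℝ (Set.range ![P, B, C])) ⊆
      segment ℝ P B ∪ segment ℝ P C ∪ segment ℝ B C := by
  have htop : affineSpan ℝ (Set.range ![P, B, C]) = ⊤ := by
    apply h.affineSpan_eq_top_iff_card_eq_finrank_add_one.2
    simp
  set b : AffineBasis (Fin 3) ℝ Pt := ⟨![P, B, C], h, htop⟩ with hb
  have hbc : (b : Fin 3 → Pt) = ![P, B, C] := rfl
  rintro y ⟨hy1, hy2⟩
  rw [((Set.finite_range _).isClosed_convexHull ℝ).closure_eq] at hy1
  rw [← hbc, b.convexHull_eq_nonneg_coord] at hy1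
  rw [← hbc, b.interior_convexHull] at hy2
  simp only [Set.mem_ofPred_eq, not_forall, not_lt] at hy1 hy2
  obtain ⟨i, hi⟩ := hy2
  have hi0 : b.coord i y = 0 := le_antisymm hi (hy1 i)
  have hsum := b.sum_coord_apply_eq_one y
  have hy := b.linear_combination_coord_eq_self y
  rw [Fin.sum_univ_three] at hsum hy
  simp only [hbc, Matrix.cons_val] at hy
  have g0 := hy1 0
  have g1 := hy1 1
  have g2 := hy1 2
  fin_cases i
  · simp only [Fin.zero_eta] at hi0
    rw [hi0] at hsum hy
    right; exact ⟨_, _, g1, g2, by linarith, by simpa using hy⟩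
  · simp only [Fin.mk_one] at hi0
    rw [hi0] at hsum hy
    left; right; exact ⟨_, _, g0, g2, by linarith, by simpa using hy⟩
  · simp only [Fin.reduceFinMk] at hi0
    rw [hi0] at hsum hy
    left; left; exact ⟨_, _, g0, g1, by linarith, by simpa using hy⟩

lemma sees_chord (P B C X : Pt) (hB : Γ.Sees P B) (hC : Γ.Sees P C)
    (hBC : segment ℝ B C ⊆ Γ.carrier) (hX : X ∈ segment ℝ B C) : Γ.Sees P X := by
  unfold Sees at *
  by_cases hind : AffineIndependent ℝ ![P, B, C]
  · have hf := triangle_frontier P B C hind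
    have hsub := Γ.no_holes (convexHull ℝ (Set.range ![P, B, C]))
      ((Set.finite_range _).isCompact_convexHull ℝ)
      (hf.trans (Set.union_subset (Set.union_subset hB hC) hBC))
    refine subset_trans ?_ hsub
    have hcv := convex_convexHull ℝ (Set.range ![P, B, C])
    have m : ∀ i, ![P, B, C] i ∈ convexHull ℝ (Set.range ![P, B, C]) := fun i =>
      subset_convexHull ℝ _ ⟨i, rfl⟩
    exact hcv.segment_subset (m 0) (hcv.segment_subset (m 1) (m 2) hX)
  · rw [affineIndependent_iff_not_collinear_set, not_not] at hind
    rcases hind.wbtw_or_wbtw_or_wbtw with h | h | h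
    · have h' : B ∈ segment ℝ P C := mem_segment_iff_wbtw.2 h
      have hX' : X ∈ segment ℝ P C :=
        (convex_segment P C).segment_subset h' (right_mem_segment ℝ P C) hX
      exact subset_trans
        ((convex_segment P C).segment_subset (left_mem_segment ℝ P C) hX') hC
    · have h' : C ∈ segment ℝ P B := by
        rw [segment_symm]; exact mem_segment_iff_wbtw.2 h
      have hX' : X ∈ segment ℝ P B :=
        (convex_segment P B).segment_subset (right_mem_segment ℝ P B) h' hX
      exact subset_trans
        ((convex_segment P B).segment_subset (left_mem_segment ℝ P B) hX') hB
    · have h' : P ∈ segment ℝ B C := by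
        rw [segment_symm]; exact mem_segment_iff_wbtw.2 h
      exact subset_trans ((convex_segment B C).segment_subset h' hX) hBC

lemma exit_point (X Y : Pt) (hX : X ∈ Γ.carrier) (hY : Y ∉ Γ.carrier) :
    ∃ B ∈ frontier Γ.carrier, B ∈ segment ℝ X Y ∧ segment ℝ X B ⊆ Γ.carrier := by
  set γ : ℝ → Pt := fun t => X + t • (Y - X) with hγ
  have hc : Continuous γ := by fun_prop
  have hK : IsCompact (Set.Icc (0:ℝ) 1 ∩ γ ⁻¹' (closure Γ.carrierᶜ)) :=
    isCompact_Icc.inter_right (isClosed_closure.preimage hc)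
  have hne : (Set.Icc (0:ℝ) 1 ∩ γ ⁻¹' (closure Γ.carrierᶜ)).Nonempty :=
    ⟨1, by simp, subset_closure (by simpa [hγ] using hY)⟩
  obtain ⟨t, ⟨ht, htc⟩, hmin⟩ := hK.exists_isLeast hne
  have hlt : ∀ s, 0 ≤ s → s < t → γ s ∈ Γ.carrier := by
    intro s hs hst
    by_contra hcon
    exact absurd (hmin ⟨⟨hs, hst.le.trans ht.2⟩, subset_closure hcon⟩) (not_le.2 hst)
  have htG : γ t ∈ Γ.carrier := by
    rcases ht.1.eq_or_lt with h | h
    · rw [← h]; simpa [hγ] using hX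
    · have h1 : Set.Ico 0 t ⊆ γ ⁻¹' Γ.carrier := fun s hs => hlt s hs.1 hs.2
      have h2 := closure_minimal h1 (Γ.closed.preimage hc)
      rw [closure_Ico h.ne] at h2
      exact h2 ⟨h.le, le_rfl⟩
  refine ⟨γ t, ?_, ?_, ?_⟩
  · rw [frontier_eq_closure_inter_closure]; exact ⟨subset_closure htG, htc⟩
  · rw [segment_eq_image']; exact ⟨t, ht, rfl⟩
  · rw [segment_eq_image']
    rintro y ⟨s, hs, rfl⟩
    have : X + s • (γ t - X) = γ (s * t) := by simp [hγ, smul_smul]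
    simp only [this]
    have h1 : s * t ≤ t := by nlinarith [hs.2, ht.1]
    rcases h1.eq_or_lt with h | h
    · rw [h]; exact htG
    · exact hlt _ (mul_nonneg hs.1 ht.1) h

lemma two_cover (P Q X : Pt) (hX : X ∈ Γ.carrier)
    (hw : ∀ A ∈ frontier Γ.carrier, Γ.Sees P A ∨ Γ.Sees Q A) : Γ.Sees P X ∨ Γ.Sees Q X := by
  by_contra hcon
  push Not at hcon
  obtain ⟨hP, hQ⟩ := hcon
  obtain ⟨Y, hYs, hY⟩ := Set.not_subset.1 hQ
  have hQX : Q ≠ X := by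
    rintro rfl
    rw [segment_same] at hYs
    exact hY (hYs ▸ hX)
  -- near side
  obtain ⟨C, hCf, hCs, hXC⟩ := Γ.exit_point X Y hX hY
  -- far side
  obtain ⟨M, hM⟩ := Γ.compact.isBounded.exists_norm_le
  obtain ⟨s, hs, hZ⟩ : ∃ s : ℝ, 0 ≤ s ∧ X + s • (X - Q) ∉ Γ.carrier := by
    have hn : 0 < ‖X - Q‖ := norm_pos_iff.2 (sub_ne_zero.2 hQX.symm)
    have hM0 : 0 ≤ M := (norm_nonneg X).trans (hM X hX)
    refine ⟨(2 * M + 1) / ‖X - Q‖, by positivity, fun h => ?_⟩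
    have h1 := hM _ h
    have h2 := hM _ hX
    have h3 : ‖((2 * M + 1) / ‖X - Q‖) • (X - Q)‖ = 2 * M + 1 := by
      rw [norm_smul, Real.norm_of_nonneg (by positivity)]; field_simp
    have h4 : ‖((2 * M + 1) / ‖X - Q‖) • (X - Q)‖ ≤
        ‖X + ((2 * M + 1) / ‖X - Q‖) • (X - Q)‖ + ‖X‖ := by
      have := norm_sub_le (X + ((2 * M + 1) / ‖X - Q‖) • (X - Q)) X
      rwa [add_sub_cancel_left] at this
    linarith
  obtain ⟨B, hBf, hBs, hXB⟩ := Γ.exit_point X _ hX hZ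
  have hYQ : ∃ y : ℝ, 0 ≤ y ∧ y ≤ 1 ∧ Y = X + y • (Q - X) := by
    rw [segment_symm, segment_eq_image'] at hYs
    obtain ⟨y, hy, rfl⟩ := hYs
    exact ⟨y, hy.1, hy.2, rfl⟩
  obtain ⟨y, hy0, hy1, rfl⟩ := hYQ
  rw [segment_eq_image'] at hCs hBs
  obtain ⟨c, hc, rfl⟩ := hCs
  obtain ⟨b, hb, rfl⟩ := hBs
  simp only [add_sub_cancel_left] at *
  set d := Q - X with hd
  have hXQ : X - Q = -d := by simp [hd]
  have hQd : Q = X + d := by simp [hd]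
  rw [hXQ] at hBf hXB hZ
  have hCQ : ¬ Γ.Sees Q (X + c • y • d) := by
    intro h
    apply hY
    apply h
    rw [hQd, segment_symm, segment_eq_image']
    have hcy : c * y ≤ y := by nlinarith [hc.2]
    by_cases h1 : c * y = 1
    · refine ⟨0, by simp, ?_⟩
      have : y = 1 := by linarith
      subst this
      simp at h1; simp [h1]
    · have h2 : 0 < 1 - c * y := by
        have : c * y ≤ 1 := hcy.trans hy1
        exact sub_pos.2 (lt_of_le_of_ne this h1)
      refine ⟨(y - c * y) / (1 - c * y), ⟨div_nonneg (by linarith) h2.le,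
        (div_le_one h2).2 (by linarith)⟩, ?_⟩
      have e : X + d - (X + c • y • d) = (1 - c * y) • d := by module
      simp only [e]
      rw [smul_smul _ (1 - c * y) d, div_mul_cancel₀ _ h2.ne']
      module
  have hBQ : ¬ Γ.Sees Q (X + b • s • -d) := by
    intro h
    apply hQ
    have hbs : 0 ≤ b * s := mul_nonneg hb.1 hs
    refine subset_trans ((convex_segment _ _).segment_subset (left_mem_segment _ _ _) ?_) h
    rw [hQd, segment_eq_image']
    refine ⟨1 / (1 + b * s), ⟨by positivity, (div_le_one (by positivity)).2 (by linarith)⟩, ?_⟩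
    have e : X + b • s • -d - (X + d) = (1 + b * s) • -d := by module
    simp only [e]
    rw [smul_smul, div_mul_cancel₀ _ (by positivity)]
    module
  have hPC := (hw _ hCf).resolve_right hCQ
  have hPB := (hw _ hBf).resolve_right hBQ
  have hcy0 : 0 ≤ c * y := mul_nonneg hc.1 hy0
  have hbs0 : 0 ≤ b * s := mul_nonneg hb.1 hs
  have hXmem : X ∈ segment ℝ (X + b • s • -d) (X + c • y • d) := by
    rw [segment_eq_image']
    by_cases h0 : b * s + c * y = 0
    · refine ⟨0, by simp, ?_⟩
      have : b * s = 0 := by linarith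
      simp [smul_smul, this]
    · have hpos : 0 < b * s + c * y := lt_of_le_of_ne (by linarith) (Ne.symm h0)
      refine ⟨b * s / (b * s + c * y), ⟨by positivity, (div_le_one hpos).2 (by linarith)⟩, ?_⟩
      have e : X + c • y • d - (X + b • s • -d) = (b * s + c * y) • d := by module
      simp only [e]
      rw [smul_smul _ _ d, div_mul_cancel₀ _ hpos.ne']
      module
  refine hP (Γ.sees_chord P _ _ X hPB hPC ?_ hXmem)
  have hw' : Wbtw ℝ (X + b • s • -d) X (X + c • y • d) := mem_segment_iff_wbtw.1 hXmem
  intro z hz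
  have : z ∈ segment ℝ X (X + b • s • -d) ∪ segment ℝ X (X + c • y • d) := by
    have h1 := segment_subset_union_aux hXmem hz
    exact h1
  exact this.elim (fun h => hXB h) (fun h => hXC h)

end SimplePolygon

/-- in a non-normal polygon, any configuration of guards covering the
boundary but not the whole polygon has at least three members. -/
theorem witness_set_has_three_members (Γ : SimplePolygon) (hnn : ¬ Γ.Normal)
    (F : Set Pt) (hF : F ⊆ Γ.carrier)
    (hwalls : Γ.Covers F (frontier Γ.carrier)) (hnotall : ¬ Γ.Covers F Γ.carrier) :
    ∃ G₁ ∈ F, ∃ G₂ ∈ F, ∃ G₃ ∈ F, G₁ ≠ G₂ ∧ G₁ ≠ G₃ ∧ G₂ ≠ G₃ := by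
  by_contra hcon
  push Not at hcon
  apply hnotall
  have hne : (frontier Γ.carrier).Nonempty := by
    rw [Γ.boundary_eq]
    exact ⟨Γ.vertex 0, Set.mem_iUnion.2 ⟨0, left_mem_segment _ _ _⟩⟩
  obtain ⟨A₀, hA₀⟩ := hne
  obtain ⟨P, hP, _⟩ := hwalls A₀ hA₀
  obtain ⟨Q, hQ, hall⟩ : ∃ Q ∈ F, ∀ G ∈ F, G = P ∨ G = Q := by
    by_cases h : ∃ Q ∈ F, P ≠ Q
    · obtain ⟨Q, hQ, hPQ⟩ := h
      refine ⟨Q, hQ, fun G hG => ?_⟩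
      by_cases hPG : P = G
      · exact Or.inl hPG.symm
      · exact Or.inr (hcon P hP Q hQ G hG hPQ hPG).symm
    · push Not at h
      exact ⟨P, hP, fun G hG => Or.inl (h G hG).symm⟩
  intro X hX
  rcases Γ.two_cover P Q X hX (fun A hA => by
    obtain ⟨G, hG, hs⟩ := hwalls A hA
    rcases hall G hG with rfl | rfl
    · exact Or.inl hs
    · exact Or.inr hs) with h | h
  · exact ⟨P, hP, h⟩
  · exact ⟨Q, hQ, h⟩
end
end
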